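/- arXiv:2407.06878 — 13 statements merged into one kernel-verified Lean document; each statement's English description precedes it below -/
import Mathlib

section
/- Let A = [a_ij] be an n×n reciprocal matrix and w a positive vector in ℝⁿ. Then w is efficient for A if and only if the directed graph G(A,w) is strongly connected, i.e., for every pair of distinct indices i, j there is a directed path from i to j in G(A,w). -/
open Matrix

/-- An `n × n` real matrix is *reciprocal* if all its entries are positive and
`A j i = 1 / A i j` for all `i, j`. -/
def IsReciprocal {n : ℕ} (A : Matrix (Fin n) (Fin n) ℝ) : Prop :=
  (∀ i j, 0 < A i j) ∧ ∀ i j, A j i = 1 / A i j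

/-- A positive vector `w` is *efficient* for `A` if every positive vector `v` whose
associated consistent matrix approximates `A` at least as well entrywise is
proportional to `w`. -/
def IsEfficient {n : ℕ} (A : Matrix (Fin n) (Fin n) ℝ) (w : Fin n → ℝ) : Prop :=
  (∀ i, 0 < w i) ∧
    ∀ v : Fin n → ℝ, (∀ i, 0 < v i) →
      (∀ i j, |A i j - v i / v j| ≤ |A i j - w i / w j|) → ∃ c : ℝ, v = c • w

/-- The set of efficient vectors for `A`. -/
def EffSet {n : ℕ} (A : Matrix (Fin n) (Fin n) ℝ) : Set (Fin n → ℝ) :=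
  {w | IsEfficient A w}

/-- The cone generated by the columns of `A`: nonzero vectors of the form `A · u`
with `u` entrywise nonnegative. -/
def ConeCols {n : ℕ} (A : Matrix (Fin n) (Fin n) ℝ) : Set (Fin n → ℝ) :=
  {w | w ≠ 0 ∧ ∃ u : Fin n → ℝ, (∀ i, 0 ≤ u i) ∧ w = A.mulVec u}

/-- A *monomial* matrix: the product of a permutation matrix and a diagonal matrix
with positive diagonal entries. -/
def IsMonomial {n : ℕ} (S : Matrix (Fin n) (Fin n) ℝ) : Prop :=
  ∃ (σ : Equiv.Perm (Fin n)) (d : Fin n → ℝ), (∀ i, 0 < d i) ∧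
    S = σ.permMatrix ℝ * Matrix.diagonal d

/-- w is efficient for the reciprocal matrix A iff the digraph
G(A,w) (edge i → j for i ≠ j iff w i ≥ A i j * w j) is strongly connected. -/
theorem efficient_iff_stronglyConnected {n : ℕ} (A : Matrix (Fin n) (Fin n) ℝ)
    (hA : IsReciprocal A) (w : Fin n → ℝ) (hw : ∀ i, 0 < w i) :
    IsEfficient A w ↔
      ∀ i j : Fin n, i ≠ j →
        Relation.TransGen (fun a b : Fin n => a ≠ b ∧ A a b * w b ≤ w a) i j := by
  classical
  obtain ⟨hpos, hrec⟩ := hA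
  constructor
  · rintro ⟨-, heff⟩ i j hij
    by_contra hno
    set R : Fin n → Fin n → Prop := fun a b => a ≠ b ∧ A a b * w b ≤ w a with hR
    let S : Fin n → Prop := fun x => Relation.ReflTransGen R i x
    have hSi : S i := Relation.ReflTransGen.refl
    have hSj : ¬ S j := by
      intro h
      rcases Relation.reflTransGen_iff_eq_or_transGen.mp h with h | h
      · exact hij h.symm
      · exact hno h
    have hcut : ∀ a b, S a → ¬ S b → w a < A a b * w b := by
      intro a b ha hb
      by_contra hlt
      apply hb
      refine Relation.ReflTransGen.tail ha ⟨?_, not_lt.mp hlt⟩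
      rintro rfl
      exact hb ha
    have hev : ∀ᶠ t : ℝ in nhdsWithin 1 (Set.Ioi 1),
        ∀ a b, S a → ¬ S b → t * w a < A a b * w b := by
      rw [Filter.eventually_all]
      intro a
      rw [Filter.eventually_all]
      intro b
      by_cases h : S a ∧ ¬ S b
      · have hc : Filter.Tendsto (fun t : ℝ => t * w a) (nhds 1) (nhds (1 * w a)) :=
          (continuous_id.mul continuous_const).tendsto 1
        rw [one_mul] at hc
        have h2 := hc.eventually_lt_const (hcut a b h.1 h.2)
        filter_upwards [nhdsWithin_le_nhds h2] with t ht _ _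
        exact ht
      · exact Filter.Eventually.of_forall fun t h1 h2 => absurd ⟨h1, h2⟩ h
    obtain ⟨t, ht, ht1⟩ := (hev.and self_mem_nhdsWithin).exists
    have ht1 : 1 < t := ht1
    have ht0 : 0 < t := by linarith
    obtain ⟨c, hc⟩ := heff (fun x => if S x then t * w x else w x) (by
      intro x
      split_ifs
      · exact mul_pos ht0 (hw x)
      · exact hw x) (by
      intro a b
      have hwa := hw a
      have hwb := hw b
      by_cases ha : S a <;> by_cases hb : S b
      · simp only [ha, hb, if_true]
        rw [mul_div_mul_left _ _ ht0.ne']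
      · simp only [ha, hb, if_true, if_false]
        have h1 : w a / w b ≤ t * w a / w b := by
          gcongr
          nlinarith
        have h2 : t * w a / w b ≤ A a b := by
          rw [div_le_iff₀ hwb]
          exact (ht a b ha hb).le
        rw [abs_of_nonneg (by linarith), abs_of_nonneg (by linarith)]
        linarith
      · simp only [ha, hb, if_true, if_false]
        have h1 : w a / (t * w b) ≤ w a / w b := by
          gcongr
          nlinarith
        have h2 : A a b ≤ w a / (t * w b) := by
          rw [hrec b a, div_le_div_iff₀ (hpos b a) (mul_pos ht0 hwb)]
          have := ht b a hb ha
          linarith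
        rw [abs_of_nonpos (by linarith), abs_of_nonpos (by linarith)]
        linarith
      · simp only [ha, hb, if_false]
        exact le_refl _)
    have e1 := congrFun hc i
    have e2 := congrFun hc j
    simp only [hSi, hSj, if_true, if_false, Pi.smul_apply, smul_eq_mul] at e1 e2
    have c1 : t = c := mul_right_cancel₀ (hw i).ne' e1
    have c2 : (1 : ℝ) = c := mul_right_cancel₀ (hw j).ne' (by rw [one_mul]; exact e2)
    linarith
  · intro hconn
    refine ⟨hw, fun v hv hle => ?_⟩
    have hstep : ∀ a b, A a b * w b ≤ w a → v a / w a ≤ v b / w b := by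
      intro a b hab
      have h1 : A a b ≤ w a / w b := by rwa [le_div_iff₀ (hw b)]
      have h2 := hle a b
      rw [abs_of_nonpos (by linarith : A a b - w a / w b ≤ 0)] at h2
      have h3 : v a / v b ≤ w a / w b := by
        have := (abs_le.mp h2).1
        linarith
      rw [div_le_div_iff₀ (hv b) (hw b)] at h3
      rw [div_le_div_iff₀ (hw a) (hw b)]
      linarith
    have hpath : ∀ i j, v i / w i ≤ v j / w j := by
      intro i j
      by_cases hij : i = j
      · rw [hij]
      · have h := hconn i j hij
        induction h with
        | single h => exact hstep _ _ h.2
        | @tail b c hib h ih =>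
          by_cases hb : i = b
          · subst hb
            exact hstep _ _ h.2
          · exact (ih hb).trans (hstep _ _ h.2)
    by_cases hne : Nonempty (Fin n)
    · obtain ⟨i⟩ := hne
      refine ⟨v i / w i, funext fun x => ?_⟩
      rw [Pi.smul_apply, smul_eq_mul, le_antisymm (hpath i x) (hpath x i),
        div_mul_cancel₀ _ (hw x).ne']
    · exact ⟨1, funext fun x => absurd ⟨x⟩ hne⟩
end

section
/- Suppose A is an n×n reciprocal matrix and w is efficient for A. If S is an n×n monomial matrix, then S A S⁻¹ is an n×n reciprocal matrix and the vector S w is efficient for S A S⁻¹. -/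
open Matrix

/-- efficiency is preserved by monomial similarity. -/
theorem efficient_monomial_similarity {n : ℕ} (A S : Matrix (Fin n) (Fin n) ℝ)
    (hA : IsReciprocal A) (w : Fin n → ℝ) (hw : IsEfficient A w)
    (hS : IsMonomial S) :
    IsReciprocal (S * A * S⁻¹) ∧ IsEfficient (S * A * S⁻¹) (S.mulVec w) := by
  obtain ⟨σ, d, hd, rfl⟩ := hS
  have hd0 : ∀ i, d i ≠ 0 := fun i => (hd i).ne'
  have hmul : ∀ M : Matrix (Fin n) (Fin n) ℝ, ∀ i j,
      (σ.permMatrix ℝ * M) i j = M (σ i) j := by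
    intro M i j
    simp [Equiv.Perm.permMatrix, PEquiv.toMatrix_toPEquiv_mul]
  have hdet : IsUnit (σ.permMatrix ℝ * Matrix.diagonal d).det := by
    rw [Matrix.det_mul, Matrix.det_permutation, Matrix.det_diagonal, isUnit_iff_ne_zero]
    refine mul_ne_zero ?_ (Finset.prod_ne_zero_iff.mpr fun i _ => hd0 i)
    rcases Int.units_eq_one_or (Equiv.Perm.sign σ) with h | h <;> simp [h]
  have hB : σ.permMatrix ℝ * Matrix.diagonal d * A * (σ.permMatrix ℝ * Matrix.diagonal d)⁻¹ =
      Matrix.of fun i j => d (σ i) * A (σ i) (σ j) / d (σ j) := by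
    have key : σ.permMatrix ℝ * Matrix.diagonal d * A =
      (Matrix.of fun i j => d (σ i) * A (σ i) (σ j) / d (σ j)) *
        (σ.permMatrix ℝ * Matrix.diagonal d) := by
      ext i j
      rw [Matrix.mul_assoc, hmul, Matrix.diagonal_mul, Matrix.mul_apply,
        Finset.sum_eq_single (σ.symm j)]
      · rw [hmul]
        simp [hd0]
      · intro k _ hk
        rw [hmul, Matrix.diagonal_apply_ne, mul_zero]
        intro h
        exact hk (by rw [← h]; simp)
      · simp
    rw [key, Matrix.mul_nonsing_inv_cancel_right _ _ hdet]
  have hv : ∀ u : Fin n → ℝ, (σ.permMatrix ℝ * Matrix.diagonal d).mulVec u =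
      fun i => d (σ i) * u (σ i) := by
    intro u
    ext i
    simp only [Matrix.mulVec, dotProduct, hmul]
    simp [Matrix.diagonal_apply]
  rw [hB, hv]
  obtain ⟨hw0, hw1⟩ := hw
  refine ⟨⟨fun i j => ?_, fun i j => ?_⟩, fun i => mul_pos (hd _) (hw0 _), ?_⟩
  · exact div_pos (mul_pos (hd _) (hA.1 _ _)) (hd _)
  · have h1 := hd0 (σ i)
    have h2 := hd0 (σ j)
    have h3 := (hA.1 (σ i) (σ j)).ne'
    simp only [Matrix.of_apply]
    rw [hA.2 (σ i) (σ j)]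
    field_simp
  · intro v hv0 hle
    obtain ⟨c, hc⟩ := hw1 (fun i => v (σ.symm i) / d i) (fun i => div_pos (hv0 _) (hd _)) (by
      intro i j
      have h := hle (σ.symm i) (σ.symm j)
      simp only [Matrix.of_apply, Equiv.apply_symm_apply] at h
      have hi := hd i
      have hj := hd j
      have e1 : d i * A i j / d j - v (σ.symm i) / v (σ.symm j) =
          d i / d j * (A i j - v (σ.symm i) / d i / (v (σ.symm j) / d j)) := by
        have := (hv0 (σ.symm j)).ne'
        field_simp
      have e2 : d i * A i j / d j - d i * w i / (d j * w j) =
          d i / d j * (A i j - w i / w j) := by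
        have := (hw0 j).ne'
        field_simp
      rw [e1, e2, abs_mul, abs_mul] at h
      exact le_of_mul_le_mul_left h (abs_pos.mpr (div_pos hi hj).ne'))
    refine ⟨c, funext fun i => ?_⟩
    have h := congrFun hc (σ i)
    simp only [Equiv.symm_apply_apply, Pi.smul_apply, smul_eq_mul] at h ⊢
    rw [div_eq_iff (hd0 _)] at h
    rw [h]; ring
end

section
/- Let A be an n×n reciprocal matrix with n ≥ 4 and w a positive vector in ℝⁿ. Then w is efficient for A if and only if there exist distinct indices i, j ∈ {1,…,n} such that w(i) is efficient for A(i) and w(j) is efficient for A(j). -/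
open Matrix

/-- `S` is strongly connected for `E` (cut formulation). -/
def StrongOn {V : Type*} (E : V → V → Prop) (S : Finset V) : Prop :=
  ∀ T ⊆ S, T.Nonempty → (∀ x ∈ T, ∀ y ∈ S, E x y → y ∈ T) → T = S

/-- The comparison digraph. -/
def EdgeRel {n : ℕ} (A : Matrix (Fin n) (Fin n) ℝ) (w : Fin n → ℝ) (x y : Fin n) : Prop :=
  A x y ≤ w x / w y

lemma strongOn_add {V : Type*} [DecidableEq V] {E : V → V → Prop} {S : Finset V}
    (hS : StrongOn E S) {o i s s' : V} (hs : s ∈ S) (hs' : s' ∈ S)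
    (h1 : E s o) (h2 : E o i) (h3 : E i s') : StrongOn E (insert o (insert i S)) := by
  intro T hT hne hcl
  have hfull : S ⊆ T → T = insert o (insert i S) := by
    intro hST
    have ho : o ∈ T := hcl s (hST hs) o (by simp) h1
    have hi : i ∈ T := hcl o ho i (by simp) h2
    apply Finset.Subset.antisymm hT
    intro z hz
    simp only [Finset.mem_insert] at hz
    rcases hz with rfl | rfl | hz
    · exact ho
    · exact hi
    · exact hST hz
  apply hfull
  have hmeet : (T ∩ S).Nonempty := by
    have hi : i ∈ T → (T ∩ S).Nonempty := fun hi =>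
      ⟨s', Finset.mem_inter.2 ⟨hcl i hi s' (by simp [hs']) h3, hs'⟩⟩
    obtain ⟨z, hz⟩ := hne
    have hz' := hT hz
    simp only [Finset.mem_insert] at hz'
    rcases hz' with rfl | rfl | hz'
    · exact hi (hcl z hz i (by simp) h2)
    · exact hi hz
    · exact ⟨z, Finset.mem_inter.2 ⟨hz, hz'⟩⟩
  have := hS (T ∩ S) Finset.inter_subset_right hmeet (by
    intro x hx y hy hxy
    rw [Finset.mem_inter] at hx ⊢
    exact ⟨hcl x hx.1 y (by simp [hy]) hxy, hy⟩)
  rw [← this]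
  exact Finset.inter_subset_left

lemma exists_deletion {V : Type*} [Fintype V] [DecidableEq V] {E : V → V → Prop}
    (hE : ∀ x y, E x y ∨ E y x) (hV : StrongOn E Finset.univ) (hc : 4 ≤ Fintype.card V) (x : V) :
    ∃ y, y ≠ x ∧ StrongOn E (Finset.univ.erase y) := by
  classical
  have hrefl : ∀ a, E a a := fun a => (hE a a).elim id id
  let P : Finset (Finset V) :=
    Finset.univ.filter fun S => x ∈ S ∧ S ≠ Finset.univ ∧ StrongOn E S
  have hP : P.Nonempty := by
    refine ⟨{x}, ?_⟩
    simp only [P, Finset.mem_filter, Finset.mem_univ, true_and, Finset.mem_singleton]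
    refine ⟨?_, ?_⟩
    · intro h
      have := congrArg Finset.card h
      rw [Finset.card_singleton, Finset.card_univ] at this
      omega
    · intro T hT hne _
      exact (Finset.Nonempty.subset_singleton_iff hne).1 hT
  obtain ⟨S, hSP, hmax⟩ := Finset.exists_max_image P Finset.card hP
  simp only [P, Finset.mem_filter, Finset.mem_univ, true_and] at hSP hmax
  obtain ⟨hxS, hSne, hS⟩ := hSP
  -- extension principle
  have key : ∀ o i s s', s ∈ S → s' ∈ S → E s o → E o i → E i s' → o ∉ S →
      insert o (insert i S) = Finset.univ := by
    intro o i s s' hs hs' h1 h2 h3 ho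
    by_contra hne
    have := hmax (insert o (insert i S)) ⟨by simp [hxS], hne, strongOn_add hS hs hs' h1 h2 h3⟩
    have hlt : S.card < (insert o (insert i S)).card := by
      apply Finset.card_lt_card
      refine ⟨fun z hz => by simp [hz], fun h => ho (h (by simp))⟩
    omega
  by_cases hone : ∃ y ∉ S, (∃ s ∈ S, E s y) ∧ ∃ s' ∈ S, E y s'
  · obtain ⟨y, hy, ⟨s, hs, h1⟩, s', hs', h2⟩ := hone
    have hu := key y y s s' hs hs' h1 (hrefl y) h2 hy
    refine ⟨y, fun h => hy (h ▸ hxS), ?_⟩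
    have : Finset.univ.erase y = S := by
      rw [← hu]; simp [hy]
    rw [this]; exact hS
  · push Not at hone
    -- O = vertices outside S dominated by S
    have hout : ∃ o ∉ S, ∃ i ∉ S, (∀ s ∈ S, E s o) ∧ E o i ∧ ∀ s ∈ S, E i s := by
      by_contra hno
      push Not at hno
      let T : Finset V := Finset.univ.filter fun y => y ∈ S ∨ ∃ s ∈ S, E s y
      have hmemT : ∀ y, y ∈ T ↔ (y ∈ S ∨ ∃ s ∈ S, E s y) := fun y => by simp [T]
      have hTu : T = Finset.univ := by
        apply hV T (Finset.subset_univ _) ⟨x, (hmemT x).2 (Or.inl hxS)⟩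
        intro a ha b _ hab
        rw [hmemT] at ha ⊢
        by_cases haS : a ∈ S
        · exact Or.inr ⟨a, haS, hab⟩
        by_contra hb
        push Not at hb
        obtain ⟨s0, hs0, hs0a⟩ := ha.resolve_left haS
        have hna := hone a haS ⟨s0, hs0, hs0a⟩
        obtain ⟨s, hs, hs2⟩ := hno a haS b hb.1
          (fun s hs => (hE s a).resolve_right (hna s hs)) hab
        exact hs2 ((hE b s).resolve_right (hb.2 s hs))
      -- then the complement of S is closed
      have hcompl : (Finset.univ \ S) = Finset.univ := by
        apply hV _ (Finset.subset_univ _)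
        · rw [Finset.sdiff_nonempty]
          intro h
          exact hSne (Finset.Subset.antisymm (Finset.subset_univ _) h)
        · intro a ha b _ hab
          simp only [Finset.mem_sdiff, Finset.mem_univ, true_and] at ha ⊢
          intro hb
          have haT : a ∈ T := by rw [hTu]; simp
          obtain ⟨s0, hs0, hs0a⟩ := ((hmemT a).1 haT).resolve_left ha
          exact hone a ha ⟨s0, hs0, hs0a⟩ b hb hab
      have : x ∈ Finset.univ \ S := by rw [hcompl]; simp
      simp [hxS] at this
    obtain ⟨o, ho, i, hi, h1, h2, h3⟩ := hout
    have hu := key o i x x hxS hxS (h1 x hxS) h2 (h3 x hxS) ho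
    have hcard : 1 < S.card := by
      have a1 := Finset.card_insert_le o (insert i S)
      have a2 := Finset.card_insert_le i S
      rw [hu, Finset.card_univ] at a1
      omega
    obtain ⟨s, hs, hsx⟩ := Finset.exists_mem_ne hcard x
    refine ⟨s, hsx, ?_⟩
    have hos : o ≠ s := fun h => ho (h ▸ hs)
    have his : i ≠ s := fun h => hi (h ▸ hs)
    intro T hT hne hcl
    have hcases : ∀ z, z = o ∨ z = i ∨ z ∈ S := by
      intro z
      have : z ∈ insert o (insert i S) := by rw [hu]; simp
      simpa using this
    have hxs : x ∈ Finset.univ.erase s := by simp [Ne.symm hsx]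
    have fromi : i ∈ T → x ∈ T := fun h => hcl i h x hxs (h3 x hxS)
    have fromo : o ∈ T → i ∈ T := fun h => hcl o h i (by simp [his]) h2
    have froms : ∀ z ∈ S, z ∈ T → o ∈ T := fun z hz h => hcl z h o (by simp [hos]) (h1 z hz)
    have hoT : o ∈ T := by
      obtain ⟨z, hz⟩ := hne
      rcases hcases z with rfl | rfl | hzS
      · exact hz
      · exact froms x hxS (fromi hz)
      · exact froms z hzS hz
    have hiT := fromo hoT
    apply Finset.Subset.antisymm hT
    intro z hz
    rcases hcases z with rfl | rfl | hzS
    · exact hoT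
    · exact hiT
    · exact hcl i hiT z hz (h3 z hzS)

lemma strong_of_two {V : Type*} [Fintype V] [DecidableEq V] {E : V → V → Prop}
    (hc : 4 ≤ Fintype.card V) {i j : V} (hij : i ≠ j)
    (hi : StrongOn E (Finset.univ.erase i)) (hj : StrongOn E (Finset.univ.erase j)) :
    StrongOn E Finset.univ := by
  intro T _ hne hcl
  obtain ⟨k, hk⟩ : ∃ k, k ∉ ({i, j} : Finset V) := by
    by_contra h
    push Not at h
    have h2 : (Finset.univ : Finset V) ⊆ {i, j} := fun z _ => h z
    have := Finset.card_le_card h2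
    rw [Finset.card_univ] at this
    have := Finset.card_le_two (a := i) (b := j)
    omega
  simp only [Finset.mem_insert, Finset.mem_singleton, not_or] at hk
  have gen : ∀ l, StrongOn E (Finset.univ.erase l) → (∃ z ∈ T, z ≠ l) → ∀ y, y ≠ l → y ∈ T := by
    intro l hl ⟨z, hz, hzl⟩ y hy
    have := hl (T.erase l) (Finset.erase_subset_erase _ (Finset.subset_univ _))
      ⟨z, by simp [hz, hzl]⟩ (by
        intro a ha b hb hab
        simp only [Finset.mem_erase, Finset.mem_univ, and_true] at ha hb ⊢
        exact ⟨hb, hcl a ha.2 b (by simp) hab⟩)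
    have hy' : y ∈ T.erase l := by rw [this]; simp [hy]
    exact (Finset.mem_erase.1 hy').2
  have hkT : k ∈ T := by
    obtain ⟨z, hz⟩ := hne
    by_cases hzi : z = i
    · exact gen j hj ⟨z, hz, hzi ▸ hij⟩ k hk.2
    · exact gen i hi ⟨z, hz, hzi⟩ k hk.1
  ext y
  simp only [Finset.mem_univ, iff_true]
  by_cases hy : y = i
  · exact gen j hj ⟨k, hkT, hk.2⟩ y (hy ▸ hij)
  · exact gen i hi ⟨k, hkT, hk.1⟩ y hy

lemma efficient_iff_strong {n : ℕ} (A : Matrix (Fin (n + 1)) (Fin (n + 1)) ℝ)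
    (hA : IsReciprocal A) (w : Fin (n + 1) → ℝ) (hw : ∀ i, 0 < w i) :
    IsEfficient A w ↔ StrongOn (EdgeRel A w) Finset.univ := by
  classical
  constructor
  · rintro ⟨-, heff⟩ T _ ⟨p, hp⟩ hcl
    by_contra hne
    obtain ⟨q, hq⟩ : ∃ q, q ∉ T := by
      by_contra h
      push Not at h
      exact hne (Finset.eq_univ_iff_forall.2 h)
    have hlt : ∀ i ∈ T, ∀ j ∉ T, w i / w j < A i j := by
      intro i hi j hj
      by_contra h
      exact hj (hcl i hi j (Finset.mem_univ _) (not_lt.1 h))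
    have hev : ∀ᶠ t : ℝ in nhdsWithin 1 (Set.Ioi 1),
        ∀ i j, i ∈ T → j ∉ T → t * (w i / w j) < A i j := by
      rw [Filter.eventually_all]; intro i
      rw [Filter.eventually_all]; intro j
      by_cases hi : i ∈ T
      swap
      · exact Filter.Eventually.of_forall fun t h => absurd h hi
      by_cases hj : j ∈ T
      · exact Filter.Eventually.of_forall fun t _ h => absurd hj h
      have hcont : Continuous fun t : ℝ => t * (w i / w j) := by fun_prop
      have h1 : (fun t : ℝ => t * (w i / w j)) 1 < A i j := by simpa using hlt i hi j hj
      have := (hcont.continuousAt.eventually_lt continuousAt_const h1)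
      filter_upwards [nhdsWithin_le_nhds this] with t ht _ _ using ht
    obtain ⟨t, ht, ht1⟩ := (hev.and self_mem_nhdsWithin).exists
    have ht1 : 1 < t := ht1
    have ht0 : 0 < t := by linarith
    obtain ⟨c, hc⟩ := heff (fun i => if i ∈ T then t * w i else w i)
      (fun i => by
        split_ifs
        · exact mul_pos ht0 (hw i)
        · exact hw i)
      (by
        intro i j
        have hwi := hw i
        have hwj := hw j
        split_ifs with hi hj hj
        · rw [mul_div_mul_left _ _ ht0.ne']
        · have h1 := ht i j hi hj
          have h2 := hlt i hi j hj
          have h3 : 0 < w i / w j := div_pos hwi hwj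
          rw [mul_div_assoc, abs_of_pos (by linarith), abs_of_pos (by linarith)]
          nlinarith
        · have h1 := ht j i hj hi
          have h3 : 0 < w j / w i := div_pos hwj hwi
          have e1 : w i / (t * w j) = 1 / (t * (w j / w i)) := by field_simp
          have e2 : w i / w j = 1 / (w j / w i) := by field_simp
          have h4 : A i j < w i / (t * w j) := by
            rw [hA.2 j i, e1]
            exact one_div_lt_one_div_of_lt (by positivity) h1
          have h5 : w i / (t * w j) ≤ w i / w j := by
            rw [e1, e2]
            exact one_div_le_one_div_of_le h3 (by nlinarith)
          rw [abs_of_neg (by linarith), abs_of_neg (by linarith)]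
          linarith
        · exact le_rfl)
    have hcp := congrFun hc p
    have hcq := congrFun hc q
    simp only [hp, hq, if_true, if_false, Pi.smul_apply, smul_eq_mul] at hcp hcq
    have e1 := mul_right_cancel₀ (hw p).ne' hcp
    have e2 : (1:ℝ) = c := mul_right_cancel₀ (hw q).ne' (by rw [one_mul]; exact hcq)
    linarith
  · intro hS
    refine ⟨hw, fun v hv hle => ?_⟩
    obtain ⟨p, -, hp⟩ := Finset.exists_max_image (Finset.univ : Finset (Fin (n + 1)))
      (fun i => v i / w i) ⟨0, Finset.mem_univ _⟩
    have hT := hS (Finset.univ.filter fun i => v p / w p ≤ v i / w i) (Finset.subset_univ _)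
      ⟨p, by simp⟩ (by
        intro i hi j _ hij
        simp only [Finset.mem_filter, Finset.mem_univ, true_and] at hi ⊢
        refine hi.trans ?_
        have h1 := hle i j
        have hij : A i j ≤ w i / w j := hij
        rw [abs_of_nonpos (a := A i j - w i / w j) (by linarith)] at h1
        have h2 := (abs_le.1 h1).1
        have h3 : v i / v j ≤ w i / w j := by linarith
        rw [div_le_div_iff₀ (hv j) (hw j)] at h3
        rw [div_le_div_iff₀ (hw i) (hw j)]
        linarith)
    refine ⟨v p / w p, ?_⟩
    ext i
    have hi : i ∈ Finset.univ.filter fun i => v p / w p ≤ v i / w i := by rw [hT]; simp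
    simp only [Finset.mem_filter, Finset.mem_univ, true_and] at hi
    have := le_antisymm hi (hp i (Finset.mem_univ _))
    rw [Pi.smul_apply, smul_eq_mul, this, div_mul_cancel₀ _ (hw i).ne']

lemma strong_map {V W : Type*} [Fintype V] [DecidableEq W] (E : W → W → Prop) (f : V ↪ W) :
    StrongOn (fun a b => E (f a) (f b)) Finset.univ ↔ StrongOn E (Finset.univ.map f) := by
  classical
  constructor
  · intro h T hT hne hcl
    have := h (Finset.univ.filter fun a => f a ∈ T) (Finset.subset_univ _)
      (by
        obtain ⟨z, hz⟩ := hne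
        obtain ⟨a, -, rfl⟩ := Finset.mem_map.1 (hT hz)
        exact ⟨a, by simp [hz]⟩)
      (by
        intro a ha b _ hab
        simp only [Finset.mem_filter, Finset.mem_univ, true_and] at ha ⊢
        exact hcl _ ha _ (by simp) hab)
    apply Finset.Subset.antisymm hT
    intro z hz
    obtain ⟨a, -, rfl⟩ := Finset.mem_map.1 hz
    have ha : a ∈ Finset.univ.filter fun a => f a ∈ T := by rw [this]; simp
    simpa using ha
  · intro h T _ hne hcl
    have := h (T.map f) (Finset.map_subset_map.2 (Finset.subset_univ _)) (hne.map) (by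
      intro x hx y hy hxy
      obtain ⟨a, ha, rfl⟩ := Finset.mem_map.1 hx
      obtain ⟨b, -, rfl⟩ := Finset.mem_map.1 hy
      exact Finset.mem_map_of_mem f (hcl a ha b (Finset.mem_univ _) hxy))
    exact Finset.map_injective f this

lemma efficient_deletion {m : ℕ} (A : Matrix (Fin (m + 4)) (Fin (m + 4)) ℝ)
    (hA : IsReciprocal A) (w : Fin (m + 4) → ℝ) (hw : ∀ i, 0 < w i) (i : Fin (m + 4)) :
    IsEfficient (A.submatrix i.succAbove i.succAbove) (w ∘ i.succAbove) ↔
      StrongOn (EdgeRel A w) (Finset.univ.erase i) := by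
  have h1 := efficient_iff_strong (n := m + 2) (A.submatrix i.succAbove i.succAbove)
    ⟨fun a b => hA.1 _ _, fun a b => hA.2 _ _⟩ (w ∘ i.succAbove) (fun a => hw _)
  have h2 := strong_map (EdgeRel A w) (Fin.succAboveEmb i)
  have h3 : Finset.univ.map (Fin.succAboveEmb i) = Finset.univ.erase i := by
    ext z
    simp [Fin.exists_succAbove_eq_iff]
  rw [h3] at h2
  exact h1.trans h2

/-- for n ≥ 4, w is efficient for A iff there are two distinct
indices i, j such that the vectors obtained by deleting entry i (resp. j) are
efficient for the corresponding principal submatrices. -/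
theorem efficient_iff_two_deletions {m : ℕ}
    (A : Matrix (Fin (m + 4)) (Fin (m + 4)) ℝ) (hA : IsReciprocal A)
    (w : Fin (m + 4) → ℝ) (hw : ∀ i, 0 < w i) :
    IsEfficient A w ↔
      ∃ i j : Fin (m + 4), i ≠ j ∧
        IsEfficient (A.submatrix i.succAbove i.succAbove) (w ∘ i.succAbove) ∧
        IsEfficient (A.submatrix j.succAbove j.succAbove) (w ∘ j.succAbove) := by
  have hc : 4 ≤ Fintype.card (Fin (m + 4)) := by simp
  have htot : ∀ x y, EdgeRel A w x y ∨ EdgeRel A w y x := by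
    intro x y
    by_contra h
    simp only [EdgeRel, not_or, not_le] at h
    obtain ⟨h1, h2⟩ := h
    have hx := hw x
    have hy := hw y
    have h3 : 0 < w x / w y := div_pos hx hy
    have e : w y / w x = 1 / (w x / w y) := by field_simp
    rw [hA.2 x y, e] at h2
    have := one_div_lt_one_div_of_lt h3 h1
    linarith
  rw [efficient_iff_strong A hA w hw]
  simp only [efficient_deletion A hA w hw]
  constructor
  · intro h
    obtain ⟨i, -, hi⟩ := exists_deletion htot h hc 0
    obtain ⟨j, hj, hj'⟩ := exists_deletion htot h hc i
    exact ⟨i, j, hj.symm, hi, hj'⟩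
  · rintro ⟨i, j, hij, hi, hj⟩
    exact strong_of_two hc hij hi hj
end

section
/- Let n ≥ 3 and x > 0, and let S_n(x) be the n×n reciprocal matrix whose (1,2) entry is x, whose (2,1) entry is 1/x, and all of whose other entries equal 1. A positive vector w = (w_1,…,w_n) ∈ ℝⁿ is efficient for S_n(x) if and only if either (w_2 ≤ w_k ≤ w_1 ≤ x·w_2 for all 3 ≤ k ≤ n) or (w_2 ≥ w_k ≥ w_1 ≥ x·w_2 for all 3 ≤ k ≤ n). -/
open Matrix

/-- Edge inequality in ratio form. -/
lemma edge_ratio {a p q r s : ℝ} (hp : 0 < p) (hq : 0 < q) (hs : 0 < s) (h : a ≤ p / q)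
    (h2 : |a - r / s| ≤ |a - p / q|) : r / p ≤ s / q := by
  rw [abs_of_nonpos (by linarith : a - p / q ≤ 0)] at h2
  have h3 := (abs_le.mp h2).1
  have h4 : r / s ≤ p / q := by linarith
  rw [div_le_div_iff₀ hs hq] at h4
  rw [div_le_div_iff₀ hp hq]
  linarith

/-- A cut without incoming edges contradicts efficiency. -/
lemma not_eff_of_cut {m : ℕ} (A : Matrix (Fin m) (Fin m) ℝ) (w : Fin m → ℝ)
    (S : Set (Fin m)) (i₀ j₀ : Fin m) (hi₀ : i₀ ∈ S) (hj₀ : j₀ ∉ S)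
    (h1 : ∀ i ∈ S, ∀ j ∉ S, A i j < w i / w j)
    (h2 : ∀ i ∈ S, ∀ j ∉ S, w j / w i < A j i) : ¬ IsEfficient A w := by
  classical
  rintro ⟨hw, h⟩
  have key : ∀ᶠ t in nhdsWithin (1:ℝ) (Set.Iio 1), ∀ i j, i ∈ S → j ∉ S →
      A i j < t * w i / w j ∧ w j / (t * w i) < A j i := by
    apply Filter.Eventually.filter_mono nhdsWithin_le_nhds
    rw [Filter.eventually_all]; intro i
    rw [Filter.eventually_all]; intro j
    by_cases hi : i ∈ S
    · by_cases hj : j ∈ S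
      · simp [hj]
      · simp only [hi, hj, not_false_eq_true, true_imp_iff]
        have hi0 := hw i
        have c1 : ContinuousAt (fun t : ℝ => t * w i / w j) 1 := by fun_prop
        have c2 : ContinuousAt (fun t : ℝ => w j / (t * w i)) 1 := by
          apply ContinuousAt.div (by fun_prop) (by fun_prop)
          simpa using hi0.ne'
        have e1 := c1.eventually (lt_mem_nhds (a := A i j) (by simpa using h1 i hi j hj))
        have e2 := c2.eventually (eventually_lt_nhds (b := A j i) (by simpa using h2 i hi j hj))
        exact e1.and e2
    · simp [hi]
  have kpos : ∀ᶠ t in nhdsWithin (1:ℝ) (Set.Iio 1), 0 < t :=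
    Filter.Eventually.filter_mono nhdsWithin_le_nhds (lt_mem_nhds one_pos)
  have klt : ∀ᶠ t in nhdsWithin (1:ℝ) (Set.Iio 1), t < 1 := self_mem_nhdsWithin
  obtain ⟨t, ⟨ht, ht0⟩, ht1⟩ := ((key.and kpos).and klt).exists
  obtain ⟨c, hc⟩ := h (fun i => if i ∈ S then t * w i else w i)
    (by
      intro i
      have := hw i
      split_ifs <;> positivity)
    (by
      intro i j
      have hwi := hw i
      have hwj := hw j
      by_cases hi : i ∈ S <;> by_cases hj : j ∈ S
      · simp only [hi, hj, if_true]
        rw [mul_div_mul_left _ _ ht0.ne']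
      · simp only [hi, hj, if_true, if_false]
        have a1 := (ht i j hi hj).1
        have a2 : t * w i / w j ≤ w i / w j := by
          gcongr
          nlinarith
        rw [abs_of_nonpos (by linarith), abs_of_nonpos (by linarith)]
        linarith
      · simp only [hi, hj, if_true, if_false]
        have a1 := (ht j i hj hi).2
        have a2 : w i / w j ≤ w i / (t * w j) := by
          gcongr
          nlinarith
        rw [abs_of_nonneg (by linarith), abs_of_nonneg (by linarith)]
        linarith
      · simp only [hi, hj, if_false]
        exact le_rfl)
  have e1 := congrFun hc i₀
  have e2 := congrFun hc j₀
  simp only [hi₀, hj₀, if_true, if_false, Pi.smul_apply, smul_eq_mul] at e1 e2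
  have f1 : t = c := mul_right_cancel₀ (hw i₀).ne' e1
  have f2 : c = 1 := mul_right_cancel₀ (hw j₀).ne' (by linarith)
  linarith

/-- Cut lemma specialised to the simple perturbed matrix: a set lying strictly above its
complement must be entered by a perturbed edge. -/
lemma cut_simple {n : ℕ} {x : ℝ} (hx : 0 < x) {w : Fin (n + 3) → ℝ} (hw : ∀ i, 0 < w i)
    (he : IsEfficient
      (Matrix.of fun i j : Fin (n + 3) =>
        if i = 0 ∧ j = 1 then x else if i = 1 ∧ j = 0 then 1 / x else 1) w)
    (S : Set (Fin (n + 3))) (i₀ j₀ : Fin (n + 3)) (hi₀ : i₀ ∈ S) (hj₀ : j₀ ∉ S)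
    (h : ∀ i ∈ S, ∀ j ∉ S, w j < w i) :
    (0 ∈ S ∧ 1 ∉ S ∧ w 0 ≤ x * w 1) ∨ (1 ∈ S ∧ 0 ∉ S ∧ x * w 1 ≤ w 0) := by
  by_contra hcon
  push Not at hcon
  obtain ⟨c1, c2⟩ := hcon
  refine not_eff_of_cut _ w S i₀ j₀ hi₀ hj₀ ?_ ?_ he
  · intro i hi j hj
    have hwi := hw i
    have hwj := hw j
    have hij := h i hi j hj
    simp only [Matrix.of_apply]
    split_ifs with g1 g2
    · obtain ⟨rfl, rfl⟩ := g1
      rw [lt_div_iff₀ hwj]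
      exact c1 hi hj
    · obtain ⟨rfl, rfl⟩ := g2
      rw [div_lt_div_iff₀ hx hwj]
      linarith [c2 hi hj]
    · rwa [one_lt_div hwj]
  · intro i hi j hj
    have hwi := hw i
    have hwj := hw j
    have hij := h i hi j hj
    simp only [Matrix.of_apply]
    split_ifs with g1 g2
    · obtain ⟨rfl, rfl⟩ := g1
      rw [div_lt_iff₀ hwi]
      exact c2 hi hj
    · obtain ⟨rfl, rfl⟩ := g2
      rw [div_lt_div_iff₀ hwi hx]
      linarith [c1 hi hj]
    · rwa [div_lt_one hwi]

/-- description of the efficient vectors for the simple perturbed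
consistent matrix S_n(x) (entry (1,2) equal to x, entry (2,1) equal to 1/x,
all other entries 1), for n ≥ 3. -/
theorem efficient_simple_perturbed (n : ℕ) (x : ℝ) (hx : 0 < x)
    (w : Fin (n + 3) → ℝ) (hw : ∀ i, 0 < w i) :
    IsEfficient
      (Matrix.of fun i j : Fin (n + 3) =>
        if i = 0 ∧ j = 1 then x else if i = 1 ∧ j = 0 then 1 / x else 1) w ↔
      ((∀ k : Fin (n + 3), 2 ≤ (k : ℕ) → w 1 ≤ w k ∧ w k ≤ w 0) ∧ w 0 ≤ x * w 1) ∨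
      ((∀ k : Fin (n + 3), 2 ≤ (k : ℕ) → w k ≤ w 1 ∧ w 0 ≤ w k) ∧ x * w 1 ≤ w 0) := by
  constructor
  · intro he
    obtain ⟨M, hM⟩ := Finite.exists_max w
    obtain ⟨N, hN⟩ := Finite.exists_min w
    by_cases hc : w M ≤ w N
    · have hall : ∀ i, w i = w N := fun i => le_antisymm ((hM i).trans hc) (hN i)
      rcases le_total (w 0) (x * w 1) with h | h
      · exact Or.inl ⟨fun k _ => by simp [hall], h⟩
      · exact Or.inr ⟨fun k _ => by simp [hall], h⟩
    · have hc' := not_le.mp hc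
      have a := cut_simple hx hw he {i | w M ≤ w i} M N (le_refl (w M)) hc
        (fun i hi j hj => (not_le.mp hj).trans_le hi)
      have b := cut_simple hx hw he {i | w N < w i} M N hc' (lt_irrefl (w N))
        (fun i hi j hj => (not_lt.mp hj).trans_lt hi)
      simp only [Set.mem_setOf_eq, not_le, not_lt] at a b
      rcases a with ⟨a1, a2, a3⟩ | ⟨a1, a2, a3⟩
      · rcases b with ⟨b1, b2, b3⟩ | ⟨b1, b2, b3⟩
        · exact Or.inl ⟨fun k _ => ⟨b2.trans (hN k), (hM k).trans a1⟩, a3⟩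
        · linarith
      · rcases b with ⟨b1, b2, b3⟩ | ⟨b1, b2, b3⟩
        · linarith
        · exact Or.inr ⟨fun k _ => ⟨(hM k).trans a1, b2.trans (hN k)⟩, a3⟩
  · intro hcase
    refine ⟨hw, fun v hv hvw => ?_⟩
    have edge := fun i j h => edge_ratio (hw i) (hw j) (hv j) h (hvw i j)
    simp only [Matrix.of_apply] at edge
    have n01 : (0 : Fin (n + 3)) ≠ 1 := by simp [Fin.ext_iff]
    have small : ∀ k : Fin (n + 3), k = 0 ∨ k = 1 ∨ 2 ≤ (k : ℕ) := by
      intro k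
      simp only [Fin.ext_iff, Fin.val_zero, Fin.val_one]
      omega
    have ne0 : ∀ k : Fin (n + 3), 2 ≤ (k : ℕ) → k ≠ 0 := by
      rintro k hk rfl
      simp at hk
    have ne1 : ∀ k : Fin (n + 3), 2 ≤ (k : ℕ) → k ≠ 1 := by
      rintro k hk rfl
      simp at hk
    have two : 2 ≤ ((⟨2, by omega⟩ : Fin (n + 3)) : ℕ) := le_rfl
    have fin : ∀ k, v k / w k = v 0 / w 0 := by
      rcases hcase with ⟨hk, hx1⟩ | ⟨hk, hx1⟩
      · have p1 : ∀ k : Fin (n + 3), 2 ≤ (k : ℕ) → v 0 / w 0 ≤ v k / w k := by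
          intro k h2
          apply edge
          simp only [ne0 k h2, ne1 k h2, n01, and_false, false_and, if_false]
          rw [one_le_div (hw k)]
          exact (hk k h2).2
        have p2 : ∀ k : Fin (n + 3), 2 ≤ (k : ℕ) → v k / w k ≤ v 1 / w 1 := by
          intro k h2
          apply edge
          simp only [ne0 k h2, ne1 k h2, false_and, if_false]
          rw [one_le_div (hw 1)]
          exact (hk k h2).1
        have p3 : v 1 / w 1 ≤ v 0 / w 0 := by
          apply edge
          simp only [n01, n01.symm, and_self, if_false, if_true]
          rw [div_le_div_iff₀ hx (hw 0)]
          linarith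
        intro k
        rcases small k with rfl | rfl | h2
        · rfl
        · exact le_antisymm p3 ((p1 _ two).trans (p2 _ two))
        · exact le_antisymm ((p2 k h2).trans p3) (p1 k h2)
      · have p1 : ∀ k : Fin (n + 3), 2 ≤ (k : ℕ) → v 1 / w 1 ≤ v k / w k := by
          intro k h2
          apply edge
          simp only [ne0 k h2, ne1 k h2, and_false, if_false]
          rw [one_le_div (hw k)]
          exact (hk k h2).1
        have p2 : ∀ k : Fin (n + 3), 2 ≤ (k : ℕ) → v k / w k ≤ v 0 / w 0 := by
          intro k h2
          apply edge
          simp only [ne0 k h2, ne1 k h2, false_and, if_false]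
          rw [one_le_div (hw 0)]
          exact (hk k h2).2
        have p3 : v 0 / w 0 ≤ v 1 / w 1 := by
          apply edge
          simp only [and_self, if_true]
          rw [le_div_iff₀ (hw 1)]
          exact hx1
        intro k
        rcases small k with rfl | rfl | h2
        · rfl
        · exact le_antisymm ((p1 _ two).trans (p2 _ two)) p3
        · exact le_antisymm (p2 k h2) (p3.trans (p1 k h2))
    refine ⟨v 0 / w 0, ?_⟩
    funext k
    rw [Pi.smul_apply, smul_eq_mul, ← fin k, div_mul_cancel₀ _ (hw k).ne']
end

section
/- Let A be the 3×3 reciprocal matrix with rows (1, a_12, a_13), (1/a_12, 1, a_23), (1/a_13, 1/a_23, 1), where a_12, a_13, a_23 > 0. A positive vector w = (w_1, w_2, w_3) ∈ ℝ³ is efficient for A if and only if either (a_23·w_3 ≤ w_2 ≤ w_1/a_12 ≤ (a_13/a_12)·w_3) or (a_23·w_3 ≥ w_2 ≥ w_1/a_12 ≥ (a_13/a_12)·w_3). -/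
open Matrix

lemma aux_abs {a p q : ℝ} (h : (a ≤ p ∧ p ≤ q) ∨ (p ≤ a ∧ q ≤ p)) : |a - p| ≤ |a - q| := by
  rcases h with ⟨h1, h2⟩ | ⟨h1, h2⟩
  · rw [abs_of_nonpos (by linarith), abs_of_nonpos (by linarith)]; linarith
  · rw [abs_of_nonneg (by linarith), abs_of_nonneg (by linarith)]; linarith

lemma aux_pair {a x y x' y' : ℝ} (ha : 0 < a) (hx : 0 < x) (hy : 0 < y) (hx' : 0 < x')
    (hy' : 0 < y')
    (h : (a * y' ≤ x' ∧ x' * y ≤ x * y') ∨ (x' ≤ a * y' ∧ x * y' ≤ x' * y)) :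
    |a - x' / y'| ≤ |a - x / y| ∧ |1 / a - y' / x'| ≤ |1 / a - y / x| := by
  constructor
  · apply aux_abs
    rw [le_div_iff₀ hy', div_le_div_iff₀ hy' hy, div_le_iff₀ hy', div_le_div_iff₀ hy hy']
    exact h
  · apply aux_abs
    rw [div_le_div_iff₀ ha hx', div_le_div_iff₀ hx' hx, div_le_div_iff₀ hx' ha,
      div_le_div_iff₀ hx hx']
    rcases h with ⟨h1, h2⟩ | ⟨h1, h2⟩
    · right; constructor <;> linarith
    · left; constructor <;> linarith

lemma aux_eff {a12 a13 a23 : ℝ} (h12 : 0 < a12) (h13 : 0 < a13) (h23 : 0 < a23)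
    {w : Fin 3 → ℝ} (hw : ∀ i, 0 < w i)
    (he : IsEfficient !![1, a12, a13; 1 / a12, 1, a23; 1 / a13, 1 / a23, 1] w)
    {x y z : ℝ} (hx : 0 < x) (hy : 0 < y) (hz : 0 < z)
    (k12 : (|a12 - x / y| ≤ |a12 - w 0 / w 1| ∧ |1 / a12 - y / x| ≤ |1 / a12 - w 1 / w 0|))
    (k13 : (|a13 - x / z| ≤ |a13 - w 0 / w 2| ∧ |1 / a13 - z / x| ≤ |1 / a13 - w 2 / w 0|))
    (k23 : (|a23 - y / z| ≤ |a23 - w 1 / w 2| ∧ |1 / a23 - z / y| ≤ |1 / a23 - w 2 / w 1|)) :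
    ∃ c : ℝ, x = c * w 0 ∧ y = c * w 1 ∧ z = c * w 2 := by
  obtain ⟨c, hc⟩ := he.2 ![x, y, z] (by intro i; fin_cases i <;> simpa) (by
    have := (hw 0).ne'
    have := (hw 1).ne'
    have := (hw 2).ne'
    intro i j
    fin_cases i <;> fin_cases j
    · simp [hx.ne', *]
    · exact k12.1
    · exact k13.1
    · exact k12.2
    · simp [hy.ne', *]
    · exact k23.1
    · exact k13.2
    · exact k23.2
    · simp [hz.ne', *])
  exact ⟨c, congrFun hc 0, congrFun hc 1, congrFun hc 2⟩

lemma aux_dir {a p q : ℝ} (h : |a - p| ≤ |a - q|) (hq : a ≤ q) : p ≤ q := by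
  rw [abs_of_nonpos (by linarith : a - q ≤ 0)] at h
  linarith [neg_abs_le (a - p)]

lemma aux_dir' {a p q : ℝ} (h : |a - p| ≤ |a - q|) (hq : q ≤ a) : q ≤ p := by
  rw [abs_of_nonneg (by linarith : 0 ≤ a - q)] at h
  linarith [le_abs_self (a - p)]

/-- description of the efficient vectors for a 3 × 3 reciprocal
matrix. -/
theorem efficient_three_by_three (a12 a13 a23 : ℝ)
    (h12 : 0 < a12) (h13 : 0 < a13) (h23 : 0 < a23)
    (w : Fin 3 → ℝ) (hw : ∀ i, 0 < w i) :
    IsEfficient !![1, a12, a13; 1 / a12, 1, a23; 1 / a13, 1 / a23, 1] w ↔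
      (a23 * w 2 ≤ w 1 ∧ w 1 ≤ w 0 / a12 ∧ w 0 / a12 ≤ (a13 / a12) * w 2) ∨
      ((a13 / a12) * w 2 ≤ w 0 / a12 ∧ w 0 / a12 ≤ w 1 ∧ w 1 ≤ a23 * w 2) := by
  have hx := hw 0
  have hy := hw 1
  have hz := hw 2
  have e : a13 / a12 * w 2 = (a13 * w 2) / a12 := by ring
  rw [e, div_le_div_iff_of_pos_right h12, div_le_div_iff_of_pos_right h12, le_div_iff₀ h12,
    div_le_iff₀ h12]
  constructor
  · intro he
    -- scaling one coordinate
    have K0 : ∀ t, 0 < t →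
        ((a12 * w 1 ≤ t ∧ t ≤ w 0) ∨ (t ≤ a12 * w 1 ∧ w 0 ≤ t)) →
        ((a13 * w 2 ≤ t ∧ t ≤ w 0) ∨ (t ≤ a13 * w 2 ∧ w 0 ≤ t)) → t = w 0 := by
      intro t ht k1 k2
      obtain ⟨c, c0, c1, c2⟩ := aux_eff h12 h13 h23 hw he ht hy hz
        (aux_pair h12 hx hy ht hy (by simpa [mul_le_mul_iff_left₀ hy] using k1))
        (aux_pair h13 hx hz ht hz (by simpa [mul_le_mul_iff_left₀ hz] using k2))
        ⟨le_rfl, le_rfl⟩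
      have : c = 1 := by
        apply mul_right_cancel₀ hy.ne'; linarith
      rw [c0, this, one_mul]
    have K1 : ∀ t, 0 < t →
        ((a12 * t ≤ w 0 ∧ w 1 ≤ t) ∨ (w 0 ≤ a12 * t ∧ t ≤ w 1)) →
        ((a23 * w 2 ≤ t ∧ t ≤ w 1) ∨ (t ≤ a23 * w 2 ∧ w 1 ≤ t)) → t = w 1 := by
      intro t ht k1 k2
      obtain ⟨c, c0, c1, c2⟩ := aux_eff h12 h13 h23 hw he hx ht hz
        (aux_pair h12 hx hy hx ht (by simpa [mul_le_mul_iff_right₀ hx] using k1))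
        ⟨le_rfl, le_rfl⟩
        (aux_pair h23 hy hz ht hz (by simpa [mul_le_mul_iff_left₀ hz] using k2))
      have : c = 1 := by
        apply mul_right_cancel₀ hx.ne'; linarith
      rw [c1, this, one_mul]
    have K2 : ∀ t, 0 < t →
        ((a13 * t ≤ w 0 ∧ w 2 ≤ t) ∨ (w 0 ≤ a13 * t ∧ t ≤ w 2)) →
        ((a23 * t ≤ w 1 ∧ w 2 ≤ t) ∨ (w 1 ≤ a23 * t ∧ t ≤ w 2)) → t = w 2 := by
      intro t ht k1 k2
      obtain ⟨c, c0, c1, c2⟩ := aux_eff h12 h13 h23 hw he hx hy ht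
        ⟨le_rfl, le_rfl⟩
        (aux_pair h13 hx hz hx ht (by simpa [mul_le_mul_iff_right₀ hx] using k1))
        (aux_pair h23 hy hz hy ht (by simpa [mul_le_mul_iff_right₀ hy] using k2))
      have : c = 1 := by
        apply mul_right_cancel₀ hx.ne'; linarith
      rw [c2, this, one_mul]
    have p1 := mul_pos h12 hy
    have p2 := mul_pos h13 hz
    have p3 := mul_pos h23 hz
    have A1 : ¬ (w 0 < a12 * w 1 ∧ w 0 < a13 * w 2) := by
      rintro ⟨u1, u2⟩
      have hm := lt_min u1 u2
      have := K0 (min (a12 * w 1) (a13 * w 2)) (lt_min p1 p2)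
        (Or.inr ⟨min_le_left _ _, hm.le⟩) (Or.inr ⟨min_le_right _ _, hm.le⟩)
      linarith
    have A2 : ¬ (a12 * w 1 < w 0 ∧ a13 * w 2 < w 0) := by
      rintro ⟨u1, u2⟩
      have hm := max_lt u1 u2
      have := K0 (max (a12 * w 1) (a13 * w 2)) (lt_max_of_lt_left p1)
        (Or.inl ⟨le_max_left _ _, hm.le⟩) (Or.inl ⟨le_max_right _ _, hm.le⟩)
      linarith
    have B1 : ¬ (a12 * w 1 < w 0 ∧ w 1 < a23 * w 2) := by
      rintro ⟨u1, u2⟩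
      have hm := lt_min ((lt_div_iff₀' h12).2 u1) u2
      have := K1 (min (w 0 / a12) (a23 * w 2)) (lt_min (div_pos hx h12) p3)
        (Or.inl ⟨(le_div_iff₀' h12).1 (min_le_left _ _), hm.le⟩)
        (Or.inr ⟨min_le_right _ _, hm.le⟩)
      linarith
    have B2 : ¬ (w 0 < a12 * w 1 ∧ a23 * w 2 < w 1) := by
      rintro ⟨u1, u2⟩
      have hm := max_lt ((div_lt_iff₀' h12).2 u1) u2
      have := K1 (max (w 0 / a12) (a23 * w 2)) (lt_max_of_lt_right p3)
        (Or.inr ⟨(div_le_iff₀' h12).1 (le_max_left _ _), hm.le⟩)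
        (Or.inl ⟨le_max_right _ _, hm.le⟩)
      linarith
    have C1 : ¬ (a13 * w 2 < w 0 ∧ a23 * w 2 < w 1) := by
      rintro ⟨u1, u2⟩
      have hm := lt_min ((lt_div_iff₀' h13).2 u1) ((lt_div_iff₀' h23).2 u2)
      have := K2 (min (w 0 / a13) (w 1 / a23)) (lt_min (div_pos hx h13) (div_pos hy h23))
        (Or.inl ⟨(le_div_iff₀' h13).1 (min_le_left _ _), hm.le⟩)
        (Or.inl ⟨(le_div_iff₀' h23).1 (min_le_right _ _), hm.le⟩)
      linarith
    have C2 : ¬ (w 0 < a13 * w 2 ∧ w 1 < a23 * w 2) := by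
      rintro ⟨u1, u2⟩
      have hm := max_lt ((div_lt_iff₀' h13).2 u1) ((div_lt_iff₀' h23).2 u2)
      have := K2 (max (w 0 / a13) (w 1 / a23)) (lt_max_of_lt_left (div_pos hx h13))
        (Or.inr ⟨(div_le_iff₀' h13).1 (le_max_left _ _), hm.le⟩)
        (Or.inr ⟨(div_le_iff₀' h23).1 (le_max_right _ _), hm.le⟩)
      linarith
    rw [mul_comm (w 1) a12]
    clear K0 K1 K2 he
    grind
  · intro h
    refine ⟨hw, fun v hv hle => ?_⟩
    have vx := hv 0
    have vy := hv 1
    have vz := hv 2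
    have k12 : |a12 - v 0 / v 1| ≤ |a12 - w 0 / w 1| := hle 0 1
    have k13 : |a13 - v 0 / v 2| ≤ |a13 - w 0 / w 2| := hle 0 2
    have k23 : |a23 - v 1 / v 2| ≤ |a23 - w 1 / w 2| := hle 1 2
    have key : v 0 / v 1 = w 0 / w 1 ∧ v 1 / v 2 = w 1 / w 2 := by
      have ev : v 0 / v 1 * (v 1 / v 2) = v 0 / v 2 := by field_simp
      have ew : w 0 / w 1 * (w 1 / w 2) = w 0 / w 2 := by field_simp
      have q1 := div_pos vx vy
      have q2 := div_pos vy vz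
      have q3 := div_pos hx hy
      have q4 := div_pos hy hz
      rcases h with ⟨g1, g2, g3⟩ | ⟨g1, g2, g3⟩
      · have r1 := aux_dir k12 ((le_div_iff₀ hy).2 (by linarith))
        have r2 := aux_dir k23 ((le_div_iff₀ hz).2 g1)
        have r3 := aux_dir' k13 ((div_le_iff₀ hz).2 g3)
        rw [← ev, ← ew] at r3
        constructor <;> apply le_antisymm <;> first | assumption | (by_contra! hh; nlinarith)
      · have r1 := aux_dir' k12 ((div_le_iff₀ hy).2 (by linarith))
        have r2 := aux_dir' k23 ((div_le_iff₀ hz).2 g3)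
        have r3 := aux_dir k13 ((le_div_iff₀ hz).2 g1)
        rw [← ev, ← ew] at r3
        constructor <;> apply le_antisymm <;> first | assumption | (by_contra! hh; nlinarith)
    obtain ⟨e1, e2⟩ := key
    have f2 : v 1 = v 2 / w 2 * w 1 := by field_simp at e2 ⊢; linarith
    have f1 : v 0 = v 2 / w 2 * w 0 := by
      have : v 0 = w 0 / w 1 * v 1 := by rw [← e1]; field_simp
      rw [this, f2]; field_simp
    refine ⟨v 2 / w 2, ?_⟩
    ext i
    fin_cases i
    · exact f1
    · exact f2
    · show v 2 = v 2 / w 2 * w 2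
      field_simp
end

section
/- Let 2 ≤ s < n−1 and let A be the n×n reciprocal matrix whose leading s×s principal submatrix is a reciprocal matrix B and all of whose other entries equal 1. Let w = (w_1,…,w_n) be a positive vector in ℝⁿ, and suppose w_p = w_q for some distinct p, q ∈ {s+1,…,n}. Then w is efficient for A if and only if w(p) is efficient for A(p). -/
open Matrix

/-- for the block perturbed consistent matrix with leading s × s
block B and all other entries 1, if w p = w q for distinct p, q outside the
block, then w is efficient iff the deletion of entry p is efficient for the
corresponding principal submatrix. -/
theorem efficient_iff_deletion_of_repeated {s m : ℕ} (hs : 2 ≤ s)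
    (hn : s + 1 < m + 1)
    (B : Matrix (Fin s) (Fin s) ℝ) (hB : IsReciprocal B)
    (A : Matrix (Fin (m + 1)) (Fin (m + 1)) ℝ)
    (hA : ∀ i j : Fin (m + 1), A i j =
      if h : (i : ℕ) < s ∧ (j : ℕ) < s then B ⟨i, h.1⟩ ⟨j, h.2⟩ else 1)
    (w : Fin (m + 1) → ℝ) (hw : ∀ i, 0 < w i)
    (p q : Fin (m + 1)) (hp : s ≤ (p : ℕ)) (hq : s ≤ (q : ℕ)) (hpq : p ≠ q)
    (hwpq : w p = w q) :
    IsEfficient A w ↔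
      IsEfficient (A.submatrix p.succAbove p.succAbove) (w ∘ p.succAbove) := by
  have hex : ∀ i : Fin (m + 1), ∃ k : Fin m,
      p.succAbove k = if i = p then q else i := by
    intro i
    apply Fin.exists_succAbove_eq
    split_ifs with h
    · exact hpq.symm
    · exact h
  choose t ht using hex
  have hone : ∀ x y : Fin (m + 1), s ≤ (x : ℕ) ∨ s ≤ (y : ℕ) → A x y = 1 := by
    intro x y h
    rw [hA, dif_neg]
    omega
  have hAt : ∀ i j, A (p.succAbove (t i)) (p.succAbove (t j)) = A i j := by
    intro i j
    rw [ht, ht]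
    split_ifs with h1 h2 h2
    · rw [hone _ _ (Or.inl hq), hone _ _ (Or.inl (h1 ▸ hp))]
    · rw [hone _ _ (Or.inl hq), hone _ _ (Or.inl (h1 ▸ hp))]
    · rw [hone _ _ (Or.inr hq), hone _ _ (Or.inr (h2 ▸ hp))]
    · rfl
  have hwt : ∀ i, w (p.succAbove (t i)) = w i := by
    intro i
    rw [ht]
    split_ifs with h
    · rw [h, hwpq]
    · rfl
  constructor
  · rintro ⟨-, h⟩
    refine ⟨fun i => hw _, fun v hv hd => ?_⟩
    obtain ⟨c, hc⟩ := h (v ∘ t) (fun i => hv _) (fun i j => by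
      have := hd (t i) (t j)
      simpa only [Matrix.submatrix_apply, Function.comp_apply, hAt, hwt] using this)
    refine ⟨c, funext fun k => ?_⟩
    have hk : t (p.succAbove k) = k := by
      apply Fin.succAbove_right_injective (p := p)
      rw [ht, if_neg (Fin.succAbove_ne p k)]
    have := congrFun hc (p.succAbove k)
    simpa [hk] using this
  · rintro ⟨-, h⟩
    refine ⟨hw, fun v hv hd => ?_⟩
    obtain ⟨c, hc⟩ := h (v ∘ p.succAbove) (fun i => hv _) (fun i j => hd _ _)
    have hvpq : v p = v q := by
      have h1 := hd p q
      rw [hone _ _ (Or.inl hp), hwpq, div_self (hw q).ne', sub_self, abs_zero] at h1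
      have h2 := abs_eq_zero.mp (le_antisymm h1 (abs_nonneg _))
      have h3 : v p / v q = 1 := by linarith
      exact (div_eq_one_iff_eq (hv q).ne').mp h3
    refine ⟨c, funext fun i => ?_⟩
    have hvt : v (p.succAbove (t i)) = v i := by
      rw [ht]
      split_ifs with h
      · rw [h, hvpq]
      · rfl
    have := congrFun hc (t i)
    simpa [hvt, hwt] using this
end

section
/- Let 2 ≤ s < n−1 and let A be the n×n reciprocal matrix whose leading s×s principal submatrix is a reciprocal matrix B and all of whose other entries equal 1. Then C(A) ⊆ E(A) if and only if C(A') ⊆ E(A'), where A' = A[{1,…,s+1}] is the leading (s+1)×(s+1) principal submatrix of A. -/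
open Matrix

theorem aux_eff_s6 {m n : ℕ} (M : Matrix (Fin m) (Fin m) ℝ) (e : Fin n → Fin m) (f : Fin m → Fin n)
    (hef : ∀ k, e (f k) = k) (hM : ∀ k, M k k = 1) (x : Fin m → ℝ) :
    IsEfficient (M.submatrix e e) (fun i => x (e i)) ↔ IsEfficient M x := by
  constructor
  · rintro ⟨hp, h⟩
    refine ⟨fun k => by simpa [hef] using hp (f k), fun v hv hd => ?_⟩
    obtain ⟨c, hc⟩ := h (fun i => v (e i)) (fun i => hv _) (fun i j => hd _ _)
    refine ⟨c, ?_⟩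
    funext k
    simpa [hef] using congrFun hc (f k)
  · rintro ⟨hp, h⟩
    refine ⟨fun k => hp _, fun v hv hd => ?_⟩
    obtain ⟨c, hc⟩ := h (fun k => v (f k)) (fun k => hv _)
      (fun k l => by simpa [hef] using hd (f k) (f l))
    refine ⟨c, ?_⟩
    funext i
    have h1 := hd i (f (e i))
    simp only [Matrix.submatrix_apply, hef, hM, div_self (hp (e i)).ne', sub_self, abs_zero] at h1
    have h2 : 1 - v i / v (f (e i)) = 0 := abs_nonpos_iff.mp h1
    have h3 : v i / v (f (e i)) = 1 := by linarith
    rw [div_eq_one_iff_eq (hv _).ne'] at h3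
    rw [h3]
    exact congrFun hc (e i)

theorem aux_mulVec {m n : ℕ} (M : Matrix (Fin m) (Fin m) ℝ) (e : Fin n → Fin m)
    (u : Fin n → ℝ) (i : Fin n) :
    (M.submatrix e e).mulVec u i =
      M.mulVec (fun k => ∑ j ∈ Finset.univ.filter (fun j => e j = k), u j) (e i) := by
  simp only [Matrix.mulVec, dotProduct, Matrix.submatrix_apply, Finset.mul_sum]
  rw [← Finset.sum_fiberwise Finset.univ e]
  refine Finset.sum_congr rfl fun k _ => Finset.sum_congr rfl fun j hj => ?_
  rw [(Finset.mem_filter.mp hj).2]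

theorem aux_main {m n : ℕ} (M : Matrix (Fin m) (Fin m) ℝ) (e : Fin n → Fin m)
    (f : Fin m → Fin n) (hef : ∀ k, e (f k) = k) (hM : ∀ k, M k k = 1) :
    ConeCols (M.submatrix e e) ⊆ EffSet (M.submatrix e e) ↔ ConeCols M ⊆ EffSet M := by
  constructor
  · rintro h x ⟨hx, u, hu, rfl⟩
    refine (aux_eff_s6 M e f hef hM _).mp (h ⟨?_, fun j => if f (e j) = j then u (e j) else 0, ?_, ?_⟩)
    · intro h0
      apply hx
      funext k
      simpa [hef] using congrFun h0 (f k)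
    · intro j
      dsimp only
      split_ifs
      · exact hu _
      · exact le_rfl
    · funext i
      rw [aux_mulVec]
      congr 1
      congr 1
      funext k
      rw [Finset.sum_eq_single (f k)]
      · simp [hef]
      · intro j hj hne
        rw [if_neg]
        rw [(Finset.mem_filter.mp hj).2]
        exact hne.symm
      · intro hk
        simp [hef] at hk
  · rintro h w ⟨hw, u, hu, rfl⟩
    have key : (M.submatrix e e).mulVec u = fun i =>
        M.mulVec (fun k => ∑ j ∈ Finset.univ.filter (fun j => e j = k), u j) (e i) :=
      funext fun i => aux_mulVec M e u i
    rw [key] at hw ⊢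
    refine (aux_eff_s6 M e f hef hM _).mpr (h ⟨?_, _, fun k => Finset.sum_nonneg fun j _ => hu j, rfl⟩)
    intro h0
    apply hw
    rw [h0]
    rfl

/-- for the block perturbed consistent matrix with leading s × s
block B and all other entries 1 (with s + 1 < n), the cone of the columns is
contained in the efficient set iff the same holds for the leading
(s+1) × (s+1) principal submatrix. -/
theorem coneCols_subset_iff_leading_block {s n : ℕ} (hs : 2 ≤ s)
    (hn : s + 1 < n)
    (B : Matrix (Fin s) (Fin s) ℝ) (hB : IsReciprocal B)
    (A : Matrix (Fin n) (Fin n) ℝ)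
    (hA : ∀ i j : Fin n, A i j =
      if h : (i : ℕ) < s ∧ (j : ℕ) < s then B ⟨i, h.1⟩ ⟨j, h.2⟩ else 1) :
    ConeCols A ⊆ EffSet A ↔
      ConeCols (A.submatrix (Fin.castLE hn.le) (Fin.castLE hn.le)) ⊆
        EffSet (A.submatrix (Fin.castLE hn.le) (Fin.castLE hn.le)) := by
  have hdiag : ∀ i, A i i = 1 := by
    intro i
    rw [hA]
    split_ifs with h
    · have h1 := hB.1 ⟨i, h.1⟩ ⟨i, h.1⟩
      have h2 := hB.2 ⟨i, h.1⟩ ⟨i, h.1⟩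
      rw [eq_div_iff h1.ne'] at h2
      nlinarith
    · rfl
  let e : Fin n → Fin (s + 1) := fun i => ⟨min i s, by omega⟩
  have hAe : A = (A.submatrix (Fin.castLE hn.le) (Fin.castLE hn.le)).submatrix e e := by
    ext i j
    simp only [Matrix.submatrix_apply]
    rw [hA, hA]
    by_cases h : (i : ℕ) < s ∧ (j : ℕ) < s
    · have hi : min (i : ℕ) s = i := by omega
      have hj : min (j : ℕ) s = j := by omega
      simp [e, h, hi, hj]
    · rw [dif_neg h, dif_neg]
      simp only [e, Fin.val_castLE]
      omega
  have := aux_main (A.submatrix (Fin.castLE hn.le) (Fin.castLE hn.le)) e (Fin.castLE hn.le)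
    (fun k => by ext; simp [e]; omega) (fun k => hdiag _)
  rwa [← hAe] at this
end

section
/- Let A be a 3×3 reciprocal matrix. Then the set of efficient vectors for A equals the cone generated by the columns of A, i.e., E(A) = C(A). -/
open Matrix

lemma eff_aux {x x' a : ℝ} (ha : 0 < a) (hx : 0 < x) (hx' : 0 < x')
    (h : (x ≤ x' ∧ x' ≤ a) ∨ (a ≤ x' ∧ x' ≤ x)) :
    |a - x'| ≤ |a - x| ∧ |1 / a - 1 / x'| ≤ |1 / a - 1 / x| := by
  rcases h with ⟨h1, h2⟩ | ⟨h1, h2⟩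
  · have e1 := one_div_le_one_div_of_le hx h1
    have e2 := one_div_le_one_div_of_le hx' h2
    constructor
    · rw [abs_of_nonneg (by linarith), abs_of_nonneg (by linarith)]; linarith
    · rw [abs_of_nonpos (by linarith), abs_of_nonpos (by linarith)]; linarith
  · have e1 := one_div_le_one_div_of_le ha h1
    have e2 := one_div_le_one_div_of_le hx' h2
    constructor
    · rw [abs_of_nonpos (by linarith), abs_of_nonpos (by linarith)]; linarith
    · rw [abs_of_nonneg (by linarith), abs_of_nonneg (by linarith)]; linarith

lemma eff_update {A : Matrix (Fin 3) (Fin 3) ℝ} (hA : IsReciprocal A) {w : Fin 3 → ℝ}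
    (hw : IsEfficient A w) (k l : Fin 3) (hl : l ≠ k) (m : ℝ) (hm : 0 < m) (hne : m ≠ w k)
    (h : ∀ j, j ≠ k → (w k ≤ m ∧ m ≤ A k j * w j) ∨ (A k j * w j ≤ m ∧ m ≤ w k)) : False := by
  obtain ⟨hp, hv⟩ := hw
  obtain ⟨hpos, hrec⟩ := hA
  have key : ∀ j, j ≠ k → |A k j - m / w j| ≤ |A k j - w k / w j| ∧
      |A j k - w j / m| ≤ |A j k - w j / w k| := by
    intro j hj
    have := eff_aux (hpos k j) (div_pos (hp k) (hp j)) (div_pos hm (hp j)) (by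
      rcases h j hj with ⟨h1, h2⟩ | ⟨h1, h2⟩
      · left
        exact ⟨div_le_div_of_nonneg_right h1 (hp j).le, (div_le_iff₀ (hp j)).2 h2⟩
      · right
        exact ⟨(le_div_iff₀ (hp j)).2 h1, div_le_div_of_nonneg_right h2 (hp j).le⟩)
    rw [← hrec k j, one_div_div, one_div_div] at this
    exact this
  obtain ⟨c, hc⟩ := hv (Function.update w k m) (by
    intro i
    by_cases hi : i = k
    · subst hi; simpa using hm
    · simpa [hi] using hp i) (by
    intro i j
    by_cases hi : i = k
    · by_cases hj : j = k
      · rw [hi, hj]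
        simp [div_self hm.ne', div_self (hp k).ne']
      · subst hi
        simpa [hj] using (key j hj).1
    · by_cases hj : j = k
      · subst hj
        simpa [hi] using (key i hi).2
      · simp [hi, hj])
  have e1 := congrFun hc k
  have e2 := congrFun hc l
  simp only [Function.update_self, Function.update_of_ne hl, Pi.smul_apply, smul_eq_mul] at e1 e2
  have hc1 : c = 1 := mul_right_cancel₀ (hp l).ne' (by linarith)
  rw [hc1, one_mul] at e1
  exact hne e1

lemma eff_no_gt {A : Matrix (Fin 3) (Fin 3) ℝ} (hA : IsReciprocal A) {w : Fin 3 → ℝ}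
    (hw : IsEfficient A w) (k l r : Fin 3) (hl : l ≠ k) (hall : ∀ j, j ≠ k → j = l ∨ j = r)
    (h1 : A k l * w l < w k) (h2 : A k r * w r < w k) : False := by
  have hpl := mul_pos (hA.1 k l) (hw.1 l)
  refine eff_update hA hw k l hl (max (A k l * w l) (A k r * w r)) (lt_max_of_lt_left hpl)
    (max_lt h1 h2).ne ?_
  intro j hj
  right
  rcases hall j hj with rfl | rfl
  · exact ⟨le_max_left _ _, (max_lt h1 h2).le⟩
  · exact ⟨le_max_right _ _, (max_lt h1 h2).le⟩

lemma eff_no_lt {A : Matrix (Fin 3) (Fin 3) ℝ} (hA : IsReciprocal A) {w : Fin 3 → ℝ}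
    (hw : IsEfficient A w) (k l r : Fin 3) (hl : l ≠ k) (hall : ∀ j, j ≠ k → j = l ∨ j = r)
    (h1 : w k < A k l * w l) (h2 : w k < A k r * w r) : False := by
  refine eff_update hA hw k l hl (min (A k l * w l) (A k r * w r)) ((hw.1 k).trans (lt_min h1 h2))
    (lt_min h1 h2).ne' ?_
  intro j hj
  left
  rcases hall j hj with rfl | rfl
  · exact ⟨(lt_min h1 h2).le, min_le_left _ _⟩
  · exact ⟨(lt_min h1 h2).le, min_le_right _ _⟩

lemma eff_prod {x y z x' y' z' : ℝ} (hx : 0 < x) (hy : 0 < y) (hz : 0 < z)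
    (hx' : 0 < x') (hy' : 0 < y') (hz' : 0 < z') (h : x * y * z = 1) (h' : x' * y' * z' = 1)
    (h1 : x ≤ x') (h2 : y ≤ y') (h3 : z ≤ z') : x = x' ∧ y = y' := by
  have hxy : x * y ≤ x' * y' := mul_le_mul h1 h2 hy.le hx'.le
  have e : x * y = x' * y' := by
    by_contra hne
    have := mul_lt_mul (lt_of_le_of_ne hxy hne) h3 hz (by positivity)
    linarith
  constructor
  · by_contra hne
    have := mul_lt_mul (lt_of_le_of_ne h1 hne) h2 hy hx'.le
    linarith
  · by_contra hne
    have := mul_lt_mul' h1 (lt_of_le_of_ne h2 hne) hy.le hx'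
    linarith

lemma eff_of_cyc {A : Matrix (Fin 3) (Fin 3) ℝ} {w : Fin 3 → ℝ}
    (hp : ∀ i, 0 < w i)
    (h : (A 0 1 * w 1 ≤ w 0 ∧ A 1 2 * w 2 ≤ w 1 ∧ A 2 0 * w 0 ≤ w 2) ∨
      (w 0 ≤ A 0 1 * w 1 ∧ w 1 ≤ A 1 2 * w 2 ∧ w 2 ≤ A 2 0 * w 0)) : IsEfficient A w := by
  refine ⟨hp, fun v hv hd => ?_⟩
  have prod : ∀ u : Fin 3 → ℝ, (∀ i, 0 < u i) → u 0 / u 1 * (u 1 / u 2) * (u 2 / u 0) = 1 := by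
    intro u hu
    have := (hu 0).ne'
    have := (hu 1).ne'
    have := (hu 2).ne'
    field_simp
  have down : ∀ i j, A i j * w j ≤ w i → v i / v j ≤ w i / w j := by
    intro i j hij
    have h1 := (le_div_iff₀ (hp j)).2 hij
    have h2 := hd i j
    rw [abs_of_nonpos (sub_nonpos.2 h1)] at h2
    have := (abs_le.1 h2).1
    linarith
  have up : ∀ i j, w i ≤ A i j * w j → w i / w j ≤ v i / v j := by
    intro i j hij
    have h1 := (div_le_iff₀ (hp j)).2 hij
    have h2 := hd i j
    rw [abs_of_nonneg (sub_nonneg.2 h1)] at h2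
    have := (abs_le.1 h2).2
    linarith
  have dp : ∀ u : Fin 3 → ℝ, (∀ i, 0 < u i) → ∀ i j, 0 < u i / u j :=
    fun u hu i j => div_pos (hu i) (hu j)
  have eq : v 0 / v 1 = w 0 / w 1 ∧ v 1 / v 2 = w 1 / w 2 := by
    rcases h with ⟨a, b, c⟩ | ⟨a, b, c⟩
    · exact eff_prod (dp v hv _ _) (dp v hv _ _) (dp v hv _ _) (dp w hp _ _) (dp w hp _ _)
        (dp w hp _ _) (prod v hv) (prod w hp) (down _ _ a) (down _ _ b) (down _ _ c)
    · have := eff_prod (dp w hp _ _) (dp w hp _ _) (dp w hp _ _) (dp v hv _ _) (dp v hv _ _)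
        (dp v hv _ _) (prod w hp) (prod v hv) (up _ _ a) (up _ _ b) (up _ _ c)
      exact ⟨this.1.symm, this.2.symm⟩
  obtain ⟨e1, e2⟩ := eq
  have w1 := (hp 1).ne'
  have w2 := (hp 2).ne'
  have v1 := (hv 1).ne'
  have v2 := (hv 2).ne'
  rw [div_eq_div_iff v1 w1] at e1
  rw [div_eq_div_iff v2 w2] at e2
  refine ⟨v 1 / w 1, ?_⟩
  ext i
  fin_cases i
  · simp; field_simp; linarith
  · simp; field_simp
  · simp; field_simp; linarith

lemma cyc_of_eff {A : Matrix (Fin 3) (Fin 3) ℝ} (hA : IsReciprocal A) {w : Fin 3 → ℝ}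
    (hw : IsEfficient A w) :
    (A 0 1 * w 1 ≤ w 0 ∧ A 1 2 * w 2 ≤ w 1 ∧ A 2 0 * w 0 ≤ w 2) ∨
      (w 0 ≤ A 0 1 * w 1 ∧ w 1 ≤ A 1 2 * w 2 ∧ w 2 ≤ A 2 0 * w 0) := by
  have g0 := eff_no_gt hA hw 0 1 2 (by decide) (by decide)
  have g1 := eff_no_gt hA hw 1 2 0 (by decide) (by decide)
  have g2 := eff_no_gt hA hw 2 0 1 (by decide) (by decide)
  have l0 := eff_no_lt hA hw 0 1 2 (by decide) (by decide)
  have l1 := eff_no_lt hA hw 1 2 0 (by decide) (by decide)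
  have l2 := eff_no_lt hA hw 2 0 1 (by decide) (by decide)
  have flip1 : ∀ i j, w i < A i j * w j → A j i * w i < w j := by
    intro i j h
    rw [hA.2 i j, one_div, inv_mul_lt_iff₀ (hA.1 i j)]
    exact h
  have flip2 : ∀ i j, A i j * w j < w i → w j < A j i * w i := by
    intro i j h
    rw [hA.2 i j, one_div, lt_inv_mul_iff₀ (hA.1 i j)]
    exact h
  have a1 := flip1 0 1
  have a2 := flip2 0 1
  have b1 := flip1 1 2
  have b2 := flip2 1 2
  have c1 := flip1 2 0
  have c2 := flip2 2 0
  rcases lt_trichotomy (A 0 1 * w 1) (w 0) with x | x | x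
  · left
    refine ⟨x.le, ?_, ?_⟩
    · by_contra! y
      exact l1 y (a2 x)
    · by_contra! z
      exact g0 x (c1 z)
  · rcases lt_trichotomy (A 1 2 * w 2) (w 1) with y | y | y
    · left
      refine ⟨x.le, y.le, ?_⟩
      by_contra! z
      exact l2 z (b2 y)
    · rcases le_total (A 2 0 * w 0) (w 2) with z | z
      · exact Or.inl ⟨x.le, y.le, z⟩
      · exact Or.inr ⟨x.ge, y.ge, z⟩
    · right
      refine ⟨x.ge, y.le, ?_⟩
      by_contra! z
      exact g2 z (b1 y)
  · right
    refine ⟨x.le, ?_, ?_⟩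
    · by_contra! y
      exact g1 y (a1 x)
    · by_contra! z
      exact l0 x (c2 z)

lemma cone_iff {a b c x y z : ℝ} (ha : 0 < a) (hb : 0 < b) (hc : 0 < c) (hx : 0 < x) (hy : 0 < y)
    (hz : 0 < z) :
    ((a * y ≤ x ∧ b * z ≤ y ∧ c * x ≤ z) ∨ (x ≤ a * y ∧ y ≤ b * z ∧ z ≤ c * x)) ↔
    ∃ p q r : ℝ, 0 ≤ p ∧ 0 ≤ q ∧ 0 ≤ r ∧ x = p + a * q + 1 / c * r ∧
      y = 1 / a * p + q + b * r ∧ z = c * p + 1 / b * q + r := by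
  constructor
  · intro h
    by_cases ht : a * b * c = 1
    · have hab : 0 < a * b := mul_pos ha hb
      have i1 : a * (b * z) = a * b * z := by ring
      have i2 : a * b * (c * x) = x := by rw [← mul_assoc, ht, one_mul]
      have e : y = b * z ∧ z = c * x := by
        rcases h with ⟨h1, h2, h3⟩ | ⟨h1, h2, h3⟩
        · have j1 := mul_le_mul_of_nonneg_left h2 ha.le
          have j2 := mul_le_mul_of_nonneg_left h3 hab.le
          exact ⟨mul_left_cancel₀ ha.ne' (by linarith), mul_left_cancel₀ hab.ne' (by linarith)⟩
        · have j1 := mul_le_mul_of_nonneg_left h2 ha.le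
          have j2 := mul_le_mul_of_nonneg_left h3 hab.le
          exact ⟨mul_left_cancel₀ ha.ne' (by linarith), mul_left_cancel₀ hab.ne' (by linarith)⟩
      refine ⟨x, 0, 0, hx.le, le_rfl, le_rfl, by ring, ?_, by linarith [e.2]⟩
      rw [e.1, e.2]
      field_simp
      linear_combination x * ht
    · have ht' : 1 - a * b * c ≠ 0 := fun h => ht (by linarith)
      refine ⟨a * ((y - b * z) / (1 - a * b * c)), b * ((z - c * x) / (1 - a * b * c)),
        c * ((x - a * y) / (1 - a * b * c)), ?_⟩
      have nn : 0 ≤ (y - b * z) / (1 - a * b * c) ∧ 0 ≤ (z - c * x) / (1 - a * b * c) ∧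
          0 ≤ (x - a * y) / (1 - a * b * c) := by
        have i1 : a * (b * z) = a * b * z := by ring
        have i2 : a * b * (c * x) = a * b * c * x := by ring
        have hab : 0 < a * b := mul_pos ha hb
        rcases h with ⟨h1, h2, h3⟩ | ⟨h1, h2, h3⟩
        · have j1 := mul_le_mul_of_nonneg_left h2 ha.le
          have j2 := mul_le_mul_of_nonneg_left h3 hab.le
          have : 0 ≤ 1 - a * b * c := by
            have : a * b * c * x ≤ 1 * x := by linarith
            linarith [le_of_mul_le_mul_right this hx]
          exact ⟨div_nonneg (by linarith) this, div_nonneg (by linarith) this,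
            div_nonneg (by linarith) this⟩
        · have j1 := mul_le_mul_of_nonneg_left h2 ha.le
          have j2 := mul_le_mul_of_nonneg_left h3 hab.le
          have : 1 - a * b * c ≤ 0 := by
            have : 1 * x ≤ a * b * c * x := by linarith
            linarith [le_of_mul_le_mul_right this hx]
          exact ⟨div_nonneg_of_nonpos (by linarith) this, div_nonneg_of_nonpos (by linarith) this,
            div_nonneg_of_nonpos (by linarith) this⟩
      refine ⟨mul_nonneg ha.le nn.1, mul_nonneg hb.le nn.2.1, mul_nonneg hc.le nn.2.2, ?_, ?_, ?_⟩
      all_goals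
        clear nn h
        generalize hD : 1 - a * b * c = D at *
        field_simp
        rw [← hD]
        ring
  · rintro ⟨p, q, r, hp, hq, hr, e1, e2, e3⟩
    have f1 : x - a * y = r / c * (1 - a * b * c) := by rw [e1, e2]; field_simp; ring
    have f2 : y - b * z = p / a * (1 - a * b * c) := by rw [e2, e3]; field_simp; ring
    have f3 : z - c * x = q / b * (1 - a * b * c) := by rw [e1, e3]; field_simp; ring
    have g1 := div_nonneg hr hc.le
    have g2 := div_nonneg hp ha.le
    have g3 := div_nonneg hq hb.le
    rcases le_total 0 (1 - a * b * c) with h | h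
    · left
      have := mul_nonneg g1 h
      have := mul_nonneg g2 h
      have := mul_nonneg g3 h
      exact ⟨by linarith, by linarith, by linarith⟩
    · right
      have := mul_nonpos_of_nonneg_of_nonpos g1 h
      have := mul_nonpos_of_nonneg_of_nonpos g2 h
      have := mul_nonpos_of_nonneg_of_nonpos g3 h
      exact ⟨by linarith, by linarith, by linarith⟩

/-- for a 3 × 3 reciprocal matrix, the set of efficient vectors
equals the cone generated by the columns. -/
theorem effSet_eq_coneCols_three (A : Matrix (Fin 3) (Fin 3) ℝ)
    (hA : IsReciprocal A) :
    EffSet A = ConeCols A := by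
  have diag : ∀ i, A i i = 1 := by
    intro i
    have h1 := hA.1 i i
    have h2 := hA.2 i i
    rw [eq_div_iff h1.ne'] at h2
    nlinarith
  have mv : ∀ u : Fin 3 → ℝ, A.mulVec u 0 = u 0 + A 0 1 * u 1 + 1 / A 2 0 * u 2 ∧
      A.mulVec u 1 = 1 / A 0 1 * u 0 + u 1 + A 1 2 * u 2 ∧
      A.mulVec u 2 = A 2 0 * u 0 + 1 / A 1 2 * u 1 + u 2 := by
    intro u
    rw [← hA.2 2 0, ← hA.2 0 1, ← hA.2 1 2]
    simp [Matrix.mulVec, dotProduct, Fin.sum_univ_three, diag]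
  ext w
  constructor
  · intro hw
    have hw : IsEfficient A w := hw
    obtain ⟨p, q, r, hp, hq, hr, e1, e2, e3⟩ :=
      (cone_iff (hA.1 0 1) (hA.1 1 2) (hA.1 2 0) (hw.1 0) (hw.1 1) (hw.1 2)).1 (cyc_of_eff hA hw)
    refine ⟨fun h => (hw.1 0).ne' (by rw [h]; rfl), ![p, q, r], ?_, ?_⟩
    · intro i
      fin_cases i
      · exact hp
      · exact hq
      · exact hr
    · obtain ⟨m1, m2, m3⟩ := mv ![p, q, r]
      ext i
      fin_cases i
      · exact e1.trans m1.symm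
      · exact e2.trans m2.symm
      · exact e3.trans m3.symm
  · rintro ⟨hne, u, hu, rfl⟩
    have hpos : ∀ i, 0 < A.mulVec u i := by
      intro i
      have hu0 : ∃ j, 0 < u j := by
        by_contra hcon
        push Not at hcon
        apply hne
        have : u = 0 := by
          ext j
          exact le_antisymm (hcon j) (hu j)
        rw [this, Matrix.mulVec_zero]
      obtain ⟨j, hj⟩ := hu0
      exact Finset.sum_pos' (fun k _ => mul_nonneg (hA.1 i k).le (hu k))
        ⟨j, Finset.mem_univ _, mul_pos (hA.1 i j) hj⟩
    obtain ⟨m1, m2, m3⟩ := mv u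
    exact eff_of_cyc hpos ((cone_iff (hA.1 0 1) (hA.1 1 2) (hA.1 2 0) (hpos 0) (hpos 1)
      (hpos 2)).2 ⟨u 0, u 1, u 2, hu 0, hu 1, hu 2, m1, m2, m3⟩)
end

section
/- Let n ≥ 4, let B be an (n−1)×(n−1) reciprocal matrix, and let A be the n×n reciprocal matrix whose leading (n−1)×(n−1) principal submatrix is B and whose last row and last column have all entries equal to 1. Let y ∈ ℝ^{n−1} be a nonnegative vector with entries summing to 1. If every entry of B·y is strictly greater than 1, or every entry of B·y is strictly less than 1, then the vector A·(y,0)ᵀ = (B·y, 1)ᵀ is not efficient for A; consequently C(A) is not contained in E(A). -/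
open Matrix

lemma aux_abs_s8 (x t : ℝ) (hx : 0 < x) (ht : 0 < t)
    (h : (1 < t ∧ t ≤ x) ∨ (x ≤ t ∧ t < 1)) :
    |1 - x / t| ≤ |1 - x / 1| ∧ |1 - t / x| ≤ |1 - 1 / x| := by
  rcases h with ⟨h1, h2⟩ | ⟨h1, h2⟩
  · have a1 : 1 ≤ x / t := by rw [le_div_iff₀ ht]; linarith
    have a2 : x / t ≤ x := div_le_self hx.le h1.le
    have a3 : t / x ≤ 1 := by rw [div_le_iff₀ hx]; linarith
    have a4 : 1 / x ≤ t / x := by gcongr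
    rw [div_one]
    constructor
    · rw [abs_of_nonpos (by linarith), abs_of_nonpos (by linarith)]; linarith
    · rw [abs_of_nonneg (by linarith), abs_of_nonneg (by linarith)]; linarith
  · have a1 : x / t ≤ 1 := by rw [div_le_iff₀ ht]; linarith
    have a2 : x ≤ x / t := by rw [le_div_iff₀ ht]; nlinarith
    have a3 : 1 ≤ t / x := by rw [le_div_iff₀ hx]; linarith
    have a4 : t / x ≤ 1 / x := by gcongr
    rw [div_one]
    constructor
    · rw [abs_of_nonneg (by linarith), abs_of_nonneg (by linarith)]; linarith
    · rw [abs_of_nonpos (by linarith), abs_of_nonpos (by linarith)]; linarith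

/-- if B y is entrywise strictly greater than 1 (or strictly less
than 1) for a nonnegative y with entries summing to 1, then the vector
(B y, 1) is inefficient for the bordered matrix A, and hence the cone of the
columns of A is not contained in the efficient set. -/
theorem inefficient_of_row_sums {m : ℕ}
    (B : Matrix (Fin (m + 3)) (Fin (m + 3)) ℝ) (hB : IsReciprocal B)
    (A : Matrix (Fin (m + 4)) (Fin (m + 4)) ℝ)
    (hA : ∀ i j : Fin (m + 4), A i j =
      if h : (i : ℕ) < m + 3 ∧ (j : ℕ) < m + 3 then B ⟨i, h.1⟩ ⟨j, h.2⟩ else 1)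
    (y : Fin (m + 3) → ℝ) (hy : ∀ i, 0 ≤ y i) (hsum : ∑ i, y i = 1)
    (h : (∀ i, 1 < B.mulVec y i) ∨ (∀ i, B.mulVec y i < 1)) :
    ¬ IsEfficient A (Fin.snoc (B.mulVec y) 1) ∧ ¬ ConeCols A ⊆ EffSet A := by
  have hlast : ∀ i, A i (Fin.last _) = 1 := fun i => by rw [hA]; simp
  have hlast' : ∀ i, A (Fin.last _) i = 1 := fun i => by rw [hA]; simp
  have hcast : ∀ i j : Fin (m + 3), A i.castSucc j.castSucc = B i j := fun i j => by
    rw [hA]; simp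
  have key : ¬ IsEfficient A (Fin.snoc (B.mulVec y) 1) := by
    rintro ⟨hpos, heff⟩
    set w := B.mulVec y with hw
    have hwpos : ∀ i, 0 < w i := fun i => by simpa using hpos i.castSucc
    have ht : ∃ t : ℝ, 0 < t ∧ t ≠ 1 ∧
        ∀ i, (1 < t ∧ t ≤ w i) ∨ (w i ≤ t ∧ t < 1) := by
      rcases h with h | h
      · obtain ⟨k, hk⟩ := Finite.exists_min w
        exact ⟨w k, hwpos k, (h k).ne', fun i => Or.inl ⟨h k, hk i⟩⟩
      · obtain ⟨k, hk⟩ := Finite.exists_max w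
        exact ⟨w k, hwpos k, (h k).ne, fun i => Or.inr ⟨hk i, h k⟩⟩
    obtain ⟨t, ht0, ht1, ht⟩ := ht
    obtain ⟨c, hc⟩ := heff (Fin.snoc w t) (by
      intro i
      induction i using Fin.lastCases with
      | last => simpa using ht0
      | cast i => simpa using hwpos i) (by
      intro i j
      induction i using Fin.lastCases with
      | last =>
        induction j using Fin.lastCases with
        | last => simp [ht0.ne']
        | cast j =>
          rw [hlast']
          simp only [Fin.snoc_last, Fin.snoc_castSucc]
          exact (aux_abs_s8 _ _ (hwpos j) ht0 (ht j)).2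
      | cast i =>
        induction j using Fin.lastCases with
        | last =>
          rw [hlast]
          simp only [Fin.snoc_last, Fin.snoc_castSucc]
          exact (aux_abs_s8 _ _ (hwpos i) ht0 (ht i)).1
        | cast j => simp only [Fin.snoc_castSucc]; exact le_rfl)
    have e1 := congrFun hc (Fin.castSucc 0)
    have e2 := congrFun hc (Fin.last _)
    simp only [Fin.snoc_last, Fin.snoc_castSucc, Pi.smul_apply, smul_eq_mul, mul_one] at e1 e2
    have hw0 := hwpos 0
    have : (c - 1) * w 0 = 0 := by linarith
    rcases mul_eq_zero.mp this with h' | h'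
    · apply ht1; linarith
    · linarith
  refine ⟨key, fun hsub => key (hsub ⟨?_, Fin.snoc y 0, ?_, ?_⟩)⟩
  · intro h0
    have := congrFun h0 (Fin.last _)
    simp at this
  · intro i
    induction i using Fin.lastCases with
    | last => simp
    | cast i => simpa using hy i
  · funext i
    induction i using Fin.lastCases with
    | last => simp [Matrix.mulVec, dotProduct, Fin.sum_univ_castSucc, hlast', hsum]
    | cast i => simp [Matrix.mulVec, dotProduct, Fin.sum_univ_castSucc, hcast]
end

section
/- Let A be the 4×4 reciprocal matrix with rows (1, a_12, a_13, 1), (1/a_12, 1, a_23, 1), (1/a_13, 1/a_23, 1, 1), (1, 1, 1, 1), where a_12, a_13, a_23 > 0 satisfy one of: (i) a_13 ≥ 1 and a_12, a_23 > 1; (ii) a_12 ≥ a_13 ≥ a_23 = 1; (iii) a_23 ≥ a_13 ≥ a_12 = 1; (iv) a_13 > 1 and a_12, a_23 < 1. If a_13 ≤ a_12·a_23, then C(A) ⊆ E(A). -/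
open Matrix

/-- If `w i / w j` overestimates `a`, a dominating `v` satisfies `v i / w i ≤ v j / w j`. -/
theorem edge_le {a vi vj wi wj : ℝ} (hvj : 0 < vj) (hwi : 0 < wi) (hwj : 0 < wj)
    (hw : a * wj ≤ wi) (h : |a - vi / vj| ≤ |a - wi / wj|) : vi / wi ≤ vj / wj := by
  have h1 : a ≤ wi / wj := by rwa [le_div_iff₀ hwj]
  rw [abs_of_nonpos (sub_nonpos.2 h1)] at h
  have h2 := neg_abs_le (a - vi / vj)
  have h3 : vi / vj ≤ wi / wj := by linarith
  rw [div_le_div_iff₀ hvj hwj] at h3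
  rw [div_le_div_iff₀ hwi hwj]
  linarith

/-- Lemma lsuff: sufficiency. -/
theorem coneCols_subset_effSet_of_le (a12 a13 a23 : ℝ)
    (h12 : 0 < a12) (h13 : 0 < a13) (h23 : 0 < a23)
    (hcond : ((1 ≤ a13 ∧ 1 < a12 ∧ 1 < a23) ∨
      (a13 ≤ a12 ∧ a23 ≤ a13 ∧ a23 = 1) ∨
      (a13 ≤ a23 ∧ a12 ≤ a13 ∧ a12 = 1) ∨
      (1 < a13 ∧ a12 < 1 ∧ a23 < 1)))
    (h : a13 ≤ a12 * a23) :
    ConeCols !![1, a12, a13, 1; 1 / a12, 1, a23, 1; 1 / a13, 1 / a23, 1, 1; 1, 1, 1, 1] ⊆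
      EffSet !![1, a12, a13, 1; 1 / a12, 1, a23, 1; 1 / a13, 1 / a23, 1, 1; 1, 1, 1, 1] := by
  have hge : 1 ≤ a12 ∧ 1 ≤ a13 ∧ 1 ≤ a23 := by
    rcases hcond with ⟨p, q, r⟩ | ⟨p, q, r⟩ | ⟨p, q, r⟩ | ⟨p, q, r⟩
    · exact ⟨q.le, p, r.le⟩
    · exact ⟨by linarith, by linarith, r.ge⟩
    · exact ⟨r.ge, by linarith, by linarith⟩
    · nlinarith
  obtain ⟨g12, g13, g23⟩ := hge
  rintro w ⟨hw0, u, hu, hw⟩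
  have e0 : w 0 = u 0 + a12 * u 1 + a13 * u 2 + u 3 := by
    simp [hw, Matrix.mulVec, dotProduct, Fin.sum_univ_four]
  have e1 : w 1 = 1 / a12 * u 0 + u 1 + a23 * u 2 + u 3 := by
    simp [hw, Matrix.mulVec, dotProduct, Fin.sum_univ_four]
  have e2 : w 2 = 1 / a13 * u 0 + 1 / a23 * u 1 + u 2 + u 3 := by
    simp [hw, Matrix.mulVec, dotProduct, Fin.sum_univ_four]
  have e3 : w 3 = u 0 + u 1 + u 2 + u 3 := by
    simp [hw, Matrix.mulVec, dotProduct, Fin.sum_univ_four]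
  have u0 := hu 0
  have u1 := hu 1
  have u2 := hu 2
  have u3 := hu 3
  have p3 : 0 < w 3 := by
    rcases (by rw [e3]; positivity : 0 ≤ w 3).lt_or_eq with hp | hp
    · exact hp
    · exfalso
      apply hw0
      have hz : u = 0 := by
        funext i
        fin_cases i <;> simp <;> linarith
      rw [hw, hz, Matrix.mulVec_zero]
  have i12 : 1 / a12 ≤ 1 := by rw [div_le_one h12]; exact g12
  have i13 : 1 / a13 ≤ 1 := by rw [div_le_one h13]; exact g13
  have i23 : 1 / a23 ≤ 1 := by rw [div_le_one h23]; exact g23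
  -- the cycle 0 → 3 → 2 → 1 → 0
  have c03 : 1 * w 3 ≤ w 0 := by rw [e0, e3]; nlinarith
  have c32 : 1 * w 2 ≤ w 3 := by rw [e2, e3]; nlinarith
  have c21 : 1 / a23 * w 1 ≤ w 2 := by
    have k1 : 1 / a23 * (1 / a12) ≤ 1 / a13 := by
      rw [one_div_mul_one_div]
      exact one_div_le_one_div_of_le h13 (by linarith)
    have k2 : 1 / a23 * a23 = 1 := by field_simp
    have : 1 / a23 * w 1 = (1 / a23 * (1 / a12)) * u 0 + 1 / a23 * u 1
        + (1 / a23 * a23) * u 2 + 1 / a23 * u 3 := by rw [e1]; ring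
    rw [this, k2, e2]
    nlinarith
  have c10 : 1 / a12 * w 0 ≤ w 1 := by
    have k1 : 1 / a12 * a13 ≤ a23 := by
      rw [one_div_mul_eq_div, div_le_iff₀ h12]; linarith
    have k2 : 1 / a12 * a12 = 1 := by field_simp
    have : 1 / a12 * w 0 = 1 / a12 * u 0 + (1 / a12 * a12) * u 1
        + (1 / a12 * a13) * u 2 + 1 / a12 * u 3 := by rw [e0]; ring
    rw [this, k2, e1]
    nlinarith
  have p0 : 0 < w 0 := by linarith
  have p1 : 0 < w 1 := lt_of_lt_of_le (by positivity) c10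
  have p2 : 0 < w 2 := lt_of_lt_of_le (by positivity) c21
  refine ⟨fun i => by fin_cases i <;> assumption, fun v hv hd => ?_⟩
  have d03 := edge_le (hv 3) p0 p3 c03 (hd 0 3)
  have d32 := edge_le (hv 2) p3 p2 c32 (hd 3 2)
  have d21 := edge_le (hv 1) p2 p1 c21 (hd 2 1)
  have d10 := edge_le (hv 0) p1 p0 c10 (hd 1 0)
  refine ⟨v 0 / w 0, ?_⟩
  have f1 : v 1 / w 1 = v 0 / w 0 := by linarith
  have f2 : v 2 / w 2 = v 0 / w 0 := by linarith
  have f3 : v 3 / w 3 = v 0 / w 0 := by linarith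
  rw [div_eq_iff p1.ne'] at f1
  rw [div_eq_iff p2.ne'] at f2
  rw [div_eq_iff p3.ne'] at f3
  have f0 : v 0 = v 0 / w 0 * w 0 := by field_simp
  funext i
  fin_cases i
  · exact f0
  · exact f1
  · exact f2
  · exact f3
end

section
/- Let A be the 4×4 reciprocal matrix with rows (1, a_12, a_13, 1), (1/a_12, 1, a_23, 1), (1/a_13, 1/a_23, 1, 1), (1, 1, 1, 1), where a_12, a_13, a_23 > 0 satisfy one of: (i) a_13 ≥ 1 and a_12, a_23 > 1; (ii) a_12 ≥ a_13 ≥ a_23 = 1; (iii) a_23 ≥ a_13 ≥ a_12 = 1; (iv) a_13 > 1 and a_12, a_23 < 1. If a_13 > a_12·a_23, then C(A) is not contained in E(A), i.e., there exists a vector in C(A) that is not efficient for A. -/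
open Matrix

/-- If row `k` leaves room to increase `w k`, then `w` is not efficient. -/
theorem not_eff_of_room (A : Matrix (Fin 4) (Fin 4) ℝ) (w : Fin 4 → ℝ) (k l : Fin 4)
    (hlk : l ≠ k) (m : ℝ) (hA : ∀ j, 0 < A k j) (hrec : ∀ j, A j k = 1 / A k j)
    (hwm : w k < m) (hm : ∀ j, j ≠ k → m ≤ A k j * w j) : ¬ IsEfficient A w := by
  rintro ⟨hw, hE⟩
  have hm0 : 0 < m := (hw k).trans hwm
  obtain ⟨c, hc⟩ := hE (Function.update w k m) (by
      intro i
      by_cases hi : i = k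
      · subst hi; simpa using hm0
      · simpa [hi] using hw i) (by
      intro i j
      by_cases hi : i = k
      · subst hi
        by_cases hj : j = i
        · subst hj
          simp [hm0.ne', (hw j).ne']
        · have h1 : m / w j ≤ A i j := by
            rw [div_le_iff₀ (hw j)]; exact hm j hj
          have h2 : w i / w j ≤ m / w j := div_le_div_of_nonneg_right hwm.le (hw j).le
          simp only [Function.update_self, Function.update_of_ne hj]
          rw [abs_of_nonneg (by linarith), abs_of_nonneg (by linarith)]
          linarith
      · by_cases hj : j = k
        · subst hj
          have h1 : A i j ≤ w i / m := by
            rw [hrec, div_le_div_iff₀ (hA i) hm0]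
            linarith [hm i hi, mul_comm (A j i) (w i)]
          have h2 : w i / m ≤ w i / w j :=
            div_le_div_of_nonneg_left (hw i).le (hw j) hwm.le
          simp only [Function.update_self, Function.update_of_ne hi]
          rw [abs_of_nonpos (by linarith), abs_of_nonpos (by linarith)]
          linarith
        · simp [hi, hj])
  have hl := congrFun hc l
  have hk := congrFun hc k
  simp [hlk] at hl hk
  have hc1 : c = 1 := mul_right_cancel₀ (hw l).ne' (by linarith)
  subst hc1
  linarith

/-- Lemma lnec: necessity. -/
theorem not_coneCols_subset_effSet_of_gt (a12 a13 a23 : ℝ)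
    (h12 : 0 < a12) (h13 : 0 < a13) (h23 : 0 < a23)
    (hcond : ((1 ≤ a13 ∧ 1 < a12 ∧ 1 < a23) ∨
      (a13 ≤ a12 ∧ a23 ≤ a13 ∧ a23 = 1) ∨
      (a13 ≤ a23 ∧ a12 ≤ a13 ∧ a12 = 1) ∨
      (1 < a13 ∧ a12 < 1 ∧ a23 < 1)))
    (h : a12 * a23 < a13) :
    ¬ ConeCols !![1, a12, a13, 1; 1 / a12, 1, a23, 1; 1 / a13, 1 / a23, 1, 1; 1, 1, 1, 1] ⊆
      EffSet !![1, a12, a13, 1; 1 / a12, 1, a23, 1; 1 / a13, 1 / a23, 1, 1; 1, 1, 1, 1] := by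
  intro hsub
  have key : ∀ u : Fin 4 → ℝ, (∀ i, 0 ≤ u i) → 0 < u 0 → IsEfficient
      !![1, a12, a13, 1; 1 / a12, 1, a23, 1; 1 / a13, 1 / a23, 1, 1; 1, 1, 1, 1]
      (!![1, a12, a13, 1; 1 / a12, 1, a23, 1; 1 / a13, 1 / a23, 1, 1; 1, 1, 1, 1].mulVec u) := by
    intro u hu hu0
    refine hsub ⟨?_, u, hu, rfl⟩
    intro h0
    have h3 := congrFun h0 3
    simp [Matrix.mulVec, dotProduct, Fin.sum_univ_four] at h3
    linarith [hu 1, hu 2, hu 3]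
  have main1 : 1 < a12 → 1 < a23 → False := by
    intro ha hb
    have hc : 1 < a13 := by nlinarith
    have hd : 0 < a13 - a12 * a23 := by linarith
    have ha' : 0 < a12 - 1 := by linarith
    have hb' : 0 < a23 - 1 := by linarith
    have hc' : 0 < a13 - 1 := by linarith
    obtain ⟨p, hp⟩ : ∃ p, p = 4 * a12 * a13 * (a23 - 1) := ⟨_, rfl⟩
    obtain ⟨q, hq⟩ : ∃ q, q = 2 * (a13 + 1) * (a12 - 1) := ⟨_, rfl⟩
    obtain ⟨r, hr⟩ : ∃ r, r = (a13 - a12 * a23) * (a13 + 3) := ⟨_, rfl⟩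
    have hp0 : 0 < p := by rw [hp]; positivity
    have hq0 : 0 < q := by rw [hq]; positivity
    have hr0 : 0 < r := by rw [hr]; positivity
    have e1 : p / a12 + q * a23 + r < 1 / a12 * (p + q * a13 + r) := by
      have : 1 / a12 * (p + q * a13 + r) - (p / a12 + q * a23 + r)
          = (a12 - 1) * (a13 - a12 * a23) * (a13 - 1) / a12 := by
        rw [hp, hq, hr]; field_simp; ring
      have : 0 < (a12 - 1) * (a13 - a12 * a23) * (a13 - 1) / a12 := by positivity
      linarith
    have e2 : p / a12 + q * a23 + r < a23 * (p / a13 + q + r) := by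
      have : a23 * (p / a13 + q + r) - (p / a12 + q * a23 + r)
          = (a23 - 1) * (a13 - a12 * a23) * (a13 - 1) := by
        rw [hp, hq, hr]; field_simp; ring
      have : 0 < (a23 - 1) * (a13 - a12 * a23) * (a13 - 1) := by positivity
      linarith
    have e3 : p / a12 + q * a23 + r < p + q + r := by
      have : p + q + r - (p / a12 + q * a23 + r)
          = 2 * (a23 - 1) * (a12 - 1) * (a13 - 1) := by
        rw [hp, hq, hr]; field_simp; ring
      have : 0 < 2 * (a23 - 1) * (a12 - 1) * (a13 - 1) := by positivity
      linarith
    refine not_eff_of_room _ _ 1 0 (by decide)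
      (min (1 / a12 * (p + q * a13 + r)) (min (a23 * (p / a13 + q + r)) (p + q + r)))
      ?_ ?_ ?_ ?_ (key ![p, 0, q, r] ?_ ?_)
    · intro j; fin_cases j <;> simp <;> positivity
    · intro j; fin_cases j <;> simp
    · have : (!![1, a12, a13, 1; 1 / a12, 1, a23, 1; 1 / a13, 1 / a23, 1, 1; 1, 1, 1, 1].mulVec
          ![p, 0, q, r]) 1 = p / a12 + q * a23 + r := by
        simp [Matrix.mulVec, dotProduct, Fin.sum_univ_four]; ring
      rw [this]
      exact lt_min e1 (lt_min e2 e3)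
    · intro j hj
      fin_cases j
      · refine (min_le_left _ _).trans (le_of_eq ?_)
        simp [Matrix.mulVec, dotProduct, Fin.sum_univ_four]; left; ring
      · exact absurd rfl hj
      · refine (min_le_right _ _).trans ((min_le_left _ _).trans (le_of_eq ?_))
        simp [Matrix.mulVec, dotProduct, Fin.sum_univ_four]; left; ring
      · refine (min_le_right _ _).trans ((min_le_right _ _).trans (le_of_eq ?_))
        simp [Matrix.mulVec, dotProduct, Fin.sum_univ_four]
    · intro i; fin_cases i <;> simp <;> positivity
    · simpa using hp0
  have main2 : 1 < a13 → a12 < 1 → a23 < 1 → False := by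
    intro hc ha hb
    have hd : 0 < a13 - a12 * a23 := by linarith
    have ha' : 0 < 1 - a12 := by linarith
    have hb' : 0 < 1 - a23 := by linarith
    have hc' : 0 < a13 - 1 := by linarith
    obtain ⟨p, hp⟩ : ∃ p, p = 4 * a12 * a13 * (1 - a23) := ⟨_, rfl⟩
    obtain ⟨q, hq⟩ : ∃ q, q = (a13 - 1) * (a13 + 3 * a12 * a23) := ⟨_, rfl⟩
    obtain ⟨r, hr⟩ : ∃ r, r = 2 * (1 - a12) * (a13 + a12 * a23) := ⟨_, rfl⟩
    have hp0 : 0 < p := by rw [hp]; positivity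
    have hq0 : 0 < q := by rw [hq]; positivity
    have hr0 : 0 < r := by rw [hr]; positivity
    have e1 : p + q + r < p + q * a12 + r * a13 := by
      have : p + q * a12 + r * a13 - (p + q + r)
          = (1 - a12) * (a13 - 1) * (a13 - a12 * a23) := by
        rw [hp, hq, hr]; ring
      have : 0 < (1 - a12) * (a13 - 1) * (a13 - a12 * a23) := by positivity
      linarith
    have e2 : p + q + r < p / a12 + q + r * a23 := by
      have : p / a12 + q + r * a23 - (p + q + r)
          = 2 * (1 - a12) * (1 - a23) * (a13 - a12 * a23) := by
        rw [hp, hq, hr]; field_simp; ring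
      have : 0 < 2 * (1 - a12) * (1 - a23) * (a13 - a12 * a23) := by positivity
      linarith
    have e3 : p + q + r < p / a13 + q / a23 + r := by
      have : p / a13 + q / a23 + r - (p + q + r)
          = (1 - a23) * (a13 - 1) * (a13 - a12 * a23) / a23 := by
        rw [hp, hq, hr]; field_simp; ring
      have : 0 < (1 - a23) * (a13 - 1) * (a13 - a12 * a23) / a23 := by positivity
      linarith
    refine not_eff_of_room _ _ 3 0 (by decide)
      (min (p + q * a12 + r * a13) (min (p / a12 + q + r * a23) (p / a13 + q / a23 + r)))
      ?_ ?_ ?_ ?_ (key ![p, q, r, 0] ?_ ?_)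
    · intro j; fin_cases j <;> simp
    · intro j; fin_cases j <;> simp
    · have : (!![1, a12, a13, 1; 1 / a12, 1, a23, 1; 1 / a13, 1 / a23, 1, 1; 1, 1, 1, 1].mulVec
          ![p, q, r, 0]) 3 = p + q + r := by
        simp [Matrix.mulVec, dotProduct, Fin.sum_univ_four]
      rw [this]
      exact lt_min e1 (lt_min e2 e3)
    · intro j hj
      fin_cases j
      · refine (min_le_left _ _).trans (le_of_eq ?_)
        simp [Matrix.mulVec, dotProduct, Fin.sum_univ_four]; ring
      · refine (min_le_right _ _).trans ((min_le_left _ _).trans (le_of_eq ?_))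
        simp [Matrix.mulVec, dotProduct, Fin.sum_univ_four]; ring
      · refine (min_le_right _ _).trans ((min_le_right _ _).trans (le_of_eq ?_))
        simp [Matrix.mulVec, dotProduct, Fin.sum_univ_four]; ring
      · exact absurd rfl hj
    · intro i; fin_cases i <;> simp <;> positivity
    · simpa using hp0
  rcases hcond with ⟨_, ha, hb⟩ | ⟨h1, _, h3⟩ | ⟨h1, _, h3⟩ | ⟨hc, ha, hb⟩
  · exact main1 ha hb
  · subst h3; linarith
  · subst h3; linarith
  · exact main2 hc ha hb
end

section
/- Let n ≥ 4 and let R be an n×n reciprocal matrix. Suppose S is an n×n monomial matrix such that A = S R S⁻¹ is the n×n reciprocal matrix whose leading 3×3 principal submatrix has rows (1, a_12, a_13), (1/a_12, 1, a_23), (1/a_13, 1/a_23, 1) and all of whose other entries equal 1, where a_12, a_13, a_23 > 0 satisfy one of: (i) a_13 ≥ 1 and a_12, a_23 > 1; (ii) a_12 ≥ a_13 ≥ a_23 = 1; (iii) a_23 ≥ a_13 ≥ a_12 = 1; (iv) a_13 > 1 and a_12, a_23 < 1. Then C(R) ⊆ E(R) if and only if a_13 ≤ a_12·a_23. -/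
open Matrix

lemma two_mod (m : ℕ) : 2 % (m + 4) = 2 := Nat.mod_eq_of_lt (by omega)


/-- The three-block matrix. -/
noncomputable def blk (m : ℕ) (a12 a13 a23 : ℝ) : Matrix (Fin (m + 4)) (Fin (m + 4)) ℝ := fun i j =>
  if h : (i : ℕ) < 3 ∧ (j : ℕ) < 3 then
        !![1, a12, a13; 1 / a12, 1, a23; 1 / a13, 1 / a23, 1] ⟨i, h.1⟩ ⟨j, h.2⟩
      else 1

lemma transfer {n : ℕ} (A B : Matrix (Fin n) (Fin n) ℝ) (τ : Equiv.Perm (Fin n)) (d : Fin n → ℝ)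
    (hd : ∀ i, 0 < d i) (hB : ∀ i j, B i j = d i * A (τ i) (τ j) / d j)
    (h : ConeCols A ⊆ EffSet A) : ConeCols B ⊆ EffSet B := by
  rintro w ⟨hw0, u, hu, hwu⟩
  have hw' : (fun k => w (τ.symm k) / d (τ.symm k)) ∈ ConeCols A := by
    refine ⟨?_, fun k => u (τ.symm k) / d (τ.symm k), fun k => div_nonneg (hu _) (hd _).le, ?_⟩
    · intro h0
      apply hw0
      funext i
      have := congrFun h0 (τ i)
      simpa [(hd i).ne'] using this
    · funext k
      have hk := (hd (τ.symm k)).ne'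
      rw [hwu]
      simp only [Matrix.mulVec, dotProduct]
      rw [← Equiv.sum_comp τ (fun j => A k j * (u (τ.symm j) / d (τ.symm j))), Finset.sum_div]
      refine Finset.sum_congr rfl fun j _ => ?_
      rw [hB]
      simp only [Equiv.apply_symm_apply, Equiv.symm_apply_apply]
      have := (hd j).ne'
      field_simp
  obtain ⟨hpos, heff⟩ := h hw'
  have hwpos : ∀ i, 0 < w i := by
    intro i
    have := hpos (τ i)
    simp only [Equiv.symm_apply_apply] at this
    have h2 := mul_pos this (hd i)
    rwa [div_mul_cancel₀ _ (hd i).ne'] at h2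
  refine ⟨hwpos, ?_⟩
  intro v hv hdom
  obtain ⟨c, hc⟩ := heff (fun k => v (τ.symm k) / d (τ.symm k)) (fun k => div_pos (hv _) (hd _)) (by
    intro k l
    have key : ∀ x : Fin n → ℝ, (∀ i, 0 < x i) →
        A k l - (x (τ.symm k) / d (τ.symm k)) / (x (τ.symm l) / d (τ.symm l)) =
        (d (τ.symm l) / d (τ.symm k)) *
          (B (τ.symm k) (τ.symm l) - x (τ.symm k) / x (τ.symm l)) := by
      intro x hx
      rw [hB]
      simp only [Equiv.apply_symm_apply]
      have h1 := (hd (τ.symm k)).ne'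
      have h2 := (hd (τ.symm l)).ne'
      have h3 := (hx (τ.symm l)).ne'
      field_simp
    simp only
    rw [key v hv, key w hwpos, abs_mul, abs_mul]
    exact mul_le_mul_of_nonneg_left (hdom _ _) (abs_nonneg _))
  refine ⟨c, ?_⟩
  funext i
  have := congrFun hc (τ i)
  simp only [Equiv.symm_apply_apply, Pi.smul_apply, smul_eq_mul] at this ⊢
  have h1 := (hd i).ne'
  field_simp at this
  exact this

lemma not_eff {n : ℕ} (A : Matrix (Fin n) (Fin n) ℝ) (hA : IsReciprocal A) (w : Fin n → ℝ)
    (X : Fin n → Prop) (p q : Fin n) (hp : X p) (hq : ¬ X q)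
    (h : ∀ i j, X i → ¬ X j → w i < A i j * w j) : ¬ IsEfficient A w := by
  classical
  rintro ⟨hw, he⟩
  have hev : ∀ᶠ t : ℝ in nhdsWithin 1 (Set.Ioi 1), ∀ i j, X i → ¬ X j → t * w i < A i j * w j := by
    rw [Filter.eventually_all]; intro i
    rw [Filter.eventually_all]; intro j
    by_cases hi : X i
    · by_cases hj : X j
      · simp [hj]
      · have hc : Filter.Tendsto (fun t : ℝ => t * w i) (nhdsWithin 1 (Set.Ioi 1)) (nhds (1 * w i)) :=
          ((continuous_id.mul continuous_const).tendsto 1).mono_left nhdsWithin_le_nhds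
        have := hc.eventually_lt_const (u := A i j * w j) (by simpa using h i j hi hj)
        filter_upwards [this] with t ht _ _ using ht
    · simp [hi]
  obtain ⟨t, ht, ht1⟩ := (hev.and self_mem_nhdsWithin).exists
  have ht1 : 1 < t := ht1
  have ht0 : 0 < t := by linarith
  obtain ⟨c, hc⟩ := he (fun i => if X i then t * w i else w i)
    (by intro i; by_cases hi : X i <;> simp [hi, hw i, ht0]) (by
    intro i j
    have hwi := hw i
    have hwj := hw j
    by_cases hi : X i <;> by_cases hj : X j <;> simp only [hi, hj, if_true, if_false]
    · rw [mul_div_mul_left _ _ ht0.ne']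
    · have h1 := ht i j hi hj
      have h2 : t * w i / w j ≤ A i j := by rw [div_le_iff₀ hwj]; exact h1.le
      have h3 : w i / w j ≤ t * w i / w j := by
        gcongr; nlinarith
      rw [abs_of_nonneg (by linarith), abs_of_nonneg (by linarith)]
      linarith
    · have h1 := ht j i hj hi
      have h2 : A i j ≤ w i / (t * w j) := by
        rw [hA.2 j i, div_le_div_iff₀ (hA.1 j i) (by positivity)]
        linarith
      have h3 : w i / (t * w j) ≤ w i / w j := by
        gcongr; nlinarith
      rw [abs_of_nonpos (by linarith), abs_of_nonpos (by linarith)]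
      linarith
    · exact le_rfl)
  have e1 := congrFun hc p
  have e2 := congrFun hc q
  simp only [hp, hq, if_true, if_false, Pi.smul_apply, smul_eq_mul] at e1 e2
  have h1 : t = c := mul_right_cancel₀ (hw p).ne' e1
  have h2 : 1 = c := mul_right_cancel₀ (hw q).ne' (by linarith)
  linarith

lemma edge_le_s12 {n : ℕ} (A : Matrix (Fin n) (Fin n) ℝ) (w v : Fin n → ℝ)
    (hw : ∀ i, 0 < w i) (hv : ∀ i, 0 < v i)
    (hdom : ∀ i j, |A i j - v i / v j| ≤ |A i j - w i / w j|) (i j : Fin n)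
    (h : A i j * w j ≤ w i) : v i / w i ≤ v j / w j := by
  have h1 : A i j ≤ w i / w j := by rwa [le_div_iff₀ (hw j)]
  have h2 := hdom i j
  rw [abs_of_nonpos (a := A i j - w i / w j) (by linarith)] at h2
  have h3 := neg_abs_le (A i j - v i / v j)
  have h4 : v i / v j ≤ w i / w j := by linarith
  rw [div_le_div_iff₀ (hv j) (hw j)] at h4
  rw [div_le_div_iff₀ (hw i) (hw j)]
  linarith

lemma eff_of_cycle {m : ℕ} (A : Matrix (Fin (m + 4)) (Fin (m + 4)) ℝ) (w : Fin (m + 4) → ℝ)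
    (hw : ∀ i, 0 < w i) (h10 : A 1 0 * w 0 ≤ w 1) (h21 : A 2 1 * w 1 ≤ w 2)
    (h0 : ∀ k : Fin (m + 1), A 0 k.succ.succ.succ * w k.succ.succ.succ ≤ w 0)
    (h2 : ∀ k : Fin (m + 1), A k.succ.succ.succ 2 * w 2 ≤ w k.succ.succ.succ) :
    IsEfficient A w := by
  refine ⟨hw, fun v hv hdom => ⟨v 0 / w 0, ?_⟩⟩
  have E := edge_le_s12 A w v hw hv hdom
  have a1 := E _ _ h10
  have a2 := E _ _ h21
  have a3 := fun k => E _ _ (h0 k)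
  have a4 := fun k => E _ _ (h2 k)
  have b3 := a3 0
  have b4 := a4 0
  have key : ∀ i, v i / w i = v 0 / w 0 := by
    intro i
    refine Fin.cases rfl (fun i => ?_) i
    refine Fin.cases ?_ (fun i => ?_) i
    · change v 1 / w 1 = _
      linarith
    refine Fin.cases ?_ (fun i => ?_) i
    · change v 2 / w 2 = _
      linarith
    · have := a3 i
      have := a4 i
      linarith
  funext i
  rw [Pi.smul_apply, smul_eq_mul, ← key i, div_mul_cancel₀ _ (hw i).ne']

lemma blk_recip {m : ℕ} {a12 a13 a23 : ℝ} (h12 : 0 < a12) (h13 : 0 < a13) (h23 : 0 < a23) :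
    IsReciprocal (blk m a12 a13 a23) := by
  have aux : ∀ i j : Fin 3, 0 < !![1, a12, a13; 1 / a12, 1, a23; 1 / a13, 1 / a23, 1] i j ∧
      !![1, a12, a13; 1 / a12, 1, a23; 1 / a13, 1 / a23, 1] j i =
      1 / !![1, a12, a13; 1 / a12, 1, a23; 1 / a13, 1 / a23, 1] i j := by
    intro i j
    fin_cases i <;> fin_cases j <;> simp [h12, h13, h23]
  constructor
  · intro i j
    unfold blk
    split_ifs with h
    · exact (aux _ _).1
    · exact one_pos
  · intro i j
    unfold blk
    by_cases h : (i : ℕ) < 3 ∧ (j : ℕ) < 3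
    · rw [dif_pos h, dif_pos h.symm]
      exact (aux _ _).2
    · rw [dif_neg h, dif_neg (fun h' => h h'.symm)]
      simp

section
variable {m : ℕ} (a12 a13 a23 : ℝ)

lemma blk00 : blk m a12 a13 a23 0 0 = 1 := by simp [blk]
lemma blk01 : blk m a12 a13 a23 0 1 = a12 := by simp [blk]
lemma blk02 : blk m a12 a13 a23 0 2 = a13 := by simp [blk, two_mod]
lemma blk10 : blk m a12 a13 a23 1 0 = 1 / a12 := by simp [blk]
lemma blk11 : blk m a12 a13 a23 1 1 = 1 := by simp [blk]
lemma blk12 : blk m a12 a13 a23 1 2 = a23 := by simp [blk, two_mod]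
lemma blk20 : blk m a12 a13 a23 2 0 = 1 / a13 := by simp [blk, two_mod]
lemma blk21 : blk m a12 a13 a23 2 1 = 1 / a23 := by simp [blk, two_mod]
lemma blk22 : blk m a12 a13 a23 2 2 = 1 := by simp [blk, two_mod]
lemma blk_r (i) (k : Fin (m + 1)) : blk m a12 a13 a23 i k.succ.succ.succ = 1 := by
  unfold blk
  rw [dif_neg]
  simp only [Fin.val_succ]; omega
lemma blk_l (i) (k : Fin (m + 1)) : blk m a12 a13 a23 k.succ.succ.succ i = 1 := by
  unfold blk
  rw [dif_neg]
  simp only [Fin.val_succ]; omega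

lemma blk_sum (u : Fin (m + 4) → ℝ) (i) : (blk m a12 a13 a23).mulVec u i =
    blk m a12 a13 a23 i 0 * u 0 + blk m a12 a13 a23 i 1 * u 1 + blk m a12 a13 a23 i 2 * u 2 +
      ∑ k : Fin (m + 1), u k.succ.succ.succ := by
  simp only [Matrix.mulVec, dotProduct]
  rw [Fin.sum_univ_succ, Fin.sum_univ_succ, Fin.sum_univ_succ]
  simp only [blk_r, one_mul]
  have e1 : (Fin.succ 0 : Fin (m + 4)) = 1 := rfl
  have e2 : (Fin.succ (Fin.succ 0) : Fin (m + 4)) = 2 := rfl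
  rw [e1, e2]
  ring
end

lemma eff_dir {m : ℕ} {a12 a13 a23 : ℝ} (h12 : 1 ≤ a12) (h13 : 1 ≤ a13) (h23 : 1 ≤ a23)
    (hle : a13 ≤ a12 * a23) :
    ConeCols (blk m a12 a13 a23) ⊆ EffSet (blk m a12 a13 a23) := by
  have p12 : 0 < a12 := by linarith
  have p13 : 0 < a13 := by linarith
  have p23 : 0 < a23 := by linarith
  have hA := blk_recip (m := m) p12 p13 p23
  rintro w ⟨hw0, u, hu, hw⟩
  have hwpos : ∀ i, 0 < w i := by
    intro i
    rw [hw]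
    simp only [Matrix.mulVec, dotProduct]
    have hne : ∃ j, u j ≠ 0 := by
      by_contra! hcon
      apply hw0
      rw [hw, show u = 0 from funext hcon, Matrix.mulVec_zero]
    obtain ⟨j, hj⟩ := hne
    exact Finset.sum_pos' (fun k _ => mul_nonneg (hA.1 i k).le (hu k))
      ⟨j, Finset.mem_univ _, mul_pos (hA.1 i j) (lt_of_le_of_ne (hu j) (Ne.symm hj))⟩
  have hs : 0 ≤ ∑ k : Fin (m + 1), u k.succ.succ.succ := Finset.sum_nonneg fun k _ => hu _
  have hsum := fun i => (congrFun hw i).trans (blk_sum a12 a13 a23 u i)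
  generalize (∑ k : Fin (m + 1), u k.succ.succ.succ) = s at hs hsum
  have hu0 := hu 0
  have hu1 := hu 1
  have hu2 := hu 2
  have w0 := hsum 0
  have w1 := hsum 1
  have w2 := hsum 2
  have wk := fun k : Fin (m + 1) => hsum k.succ.succ.succ
  simp only [blk00, blk01, blk02, blk10, blk11, blk12, blk20, blk21, blk22, blk_l] at w0 w1 w2 wk
  have i13 : 1 / a13 ≤ 1 := by rw [div_le_one p13]; exact h13
  have i23 : 1 / a23 ≤ 1 := by rw [div_le_one p23]; exact h23
  refine eff_of_cycle _ w hwpos ?_ ?_ ?_ ?_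
  · rw [blk10, div_mul_eq_mul_div, one_mul, div_le_iff₀ p12, w0, w1]
    have e : (1 / a12 * u 0 + 1 * u 1 + a23 * u 2 + s) * a12 =
      u 0 + a12 * u 1 + a12 * a23 * u 2 + a12 * s := by field_simp
    rw [e]
    nlinarith [mul_le_mul_of_nonneg_right hle hu2, mul_le_mul_of_nonneg_right h12 hs]
  · rw [blk21, div_mul_eq_mul_div, one_mul, div_le_iff₀ p23, w1, w2]
    have e : (1 / a13 * u 0 + 1 / a23 * u 1 + 1 * u 2 + s) * a23 =
      a23 / a13 * u 0 + u 1 + a23 * u 2 + a23 * s := by field_simp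
    rw [e]
    have : 1 / a12 ≤ a23 / a13 := by
      rw [div_le_div_iff₀ p12 p13]; linarith
    nlinarith [mul_le_mul_of_nonneg_right this hu0, mul_le_mul_of_nonneg_right h23 hs]
  · intro k
    rw [blk_r, wk, w0]
    nlinarith
  · intro k
    rw [blk_l, wk, w2]
    nlinarith

/-- Column combination used as counterexample. -/
noncomputable def cvec (m : ℕ) (x y z s : ℝ) : Fin (m + 4) → ℝ := fun i =>
  if i = 0 then x else if i = 1 then y else if i = 2 then z else if i = 3 then s else 0

lemma cvec_sum (m : ℕ) (x y z s : ℝ) :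
    ∑ k : Fin (m + 1), cvec m x y z s k.succ.succ.succ = s := by
  rw [Fin.sum_univ_succ]
  have : ∀ k : Fin m, cvec m x y z s k.succ.succ.succ.succ = 0 := by
    intro k
    unfold cvec
    rw [if_neg, if_neg, if_neg, if_neg] <;>
    · intro h
      have := congrArg Fin.val h
      simp [two_mod, Fin.val_succ, Nat.mod_eq_of_lt] at this
  have h3 : cvec m x y z s (Fin.succ (Fin.succ (Fin.succ 0))) = s := by
    change cvec m x y z s 3 = s
    unfold cvec
    rw [if_neg, if_neg, if_neg, if_pos rfl] <;>
    · intro h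
      have := congrArg Fin.val h
      simp [two_mod, Nat.mod_eq_of_lt] at this
  rw [h3]; simp [this]

lemma cvec_mem {m : ℕ} {a12 a13 a23 : ℝ} (h12 : 0 < a12) (h13 : 0 < a13) (h23 : 0 < a23)
    {x y z s : ℝ} (hx : 0 < x) (hy : 0 ≤ y) (hz : 0 ≤ z) (hs : 0 ≤ s) :
    ∃ w ∈ ConeCols (blk m a12 a13 a23), w 0 = x + a12 * y + a13 * z + s ∧
      w 1 = 1 / a12 * x + y + a23 * z + s ∧ w 2 = 1 / a13 * x + 1 / a23 * y + z + s ∧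
      ∀ k : Fin (m + 1), w k.succ.succ.succ = x + y + z + s := by
  have hsum := blk_sum a12 a13 a23 (cvec m x y z s)
  rw [cvec_sum] at hsum
  have c0 : cvec m x y z s 0 = x := by simp [cvec]
  have c1 : cvec m x y z s 1 = y := by simp [cvec]
  have c2 : cvec m x y z s 2 = z := by
    unfold cvec
    rw [if_neg, if_neg, if_pos rfl] <;>
    · intro h
      have := congrArg Fin.val h
      simp [two_mod] at this
  rw [c0, c1, c2] at hsum
  have w0 := hsum 0
  rw [blk00, blk01, blk02, one_mul] at w0
  refine ⟨(blk m a12 a13 a23).mulVec (cvec m x y z s), ⟨?_, _, ?_, rfl⟩, w0, ?_, ?_, ?_⟩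
  · intro h
    rw [h] at w0
    have : 0 < x + a12 * y + a13 * z + s := by positivity
    simp only [Pi.zero_apply] at w0
    linarith
  · intro i
    unfold cvec
    split_ifs <;> linarith
  · rw [hsum, blk10, blk11, blk12, one_mul]
  · rw [hsum, blk20, blk21, blk22, one_mul]
  · intro k
    rw [hsum, blk_l, blk_l, blk_l]; ring

/-- Case split on an index. -/
lemma idx_cases {m : ℕ} (P : Fin (m + 4) → Prop) (h0 : P 0) (h1 : P 1) (h2 : P 2)
    (hk : ∀ k : Fin (m + 1), P k.succ.succ.succ) : ∀ i, P i := by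
  intro i
  refine Fin.cases h0 (fun i => ?_) i
  refine Fin.cases h1 (fun i => ?_) i
  refine Fin.cases h2 (fun i => hk i) i

lemma not_dir1 {m : ℕ} {a12 a13 a23 : ℝ} (h12 : 1 < a12) (h23 : 1 < a23)
    (hlt : a12 * a23 < a13) :
    ¬ (ConeCols (blk m a12 a13 a23) ⊆ EffSet (blk m a12 a13 a23)) := by
  intro hsub
  have h13 : 1 < a13 := by nlinarith
  have p12 : 0 < a12 := by linarith
  have p13 : 0 < a13 := by linarith
  have p23 : 0 < a23 := by linarith
  have hA := blk_recip (m := m) p12 p13 p23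
  obtain ⟨l, hl1, hl2⟩ := exists_between h13
  obtain ⟨q, hq1, hq2⟩ := exists_between hl2
  obtain ⟨w, hw, w0, w1, w2, wk⟩ := cvec_mem (m := m) p12 p13 p23
    (x := (a23 - 1) * a12 * q) (y := 0) (z := (a12 - 1) * l) (s := a13 - a12 * a23)
    (mul_pos (mul_pos (by linarith) p12) (by linarith)) le_rfl
    (mul_nonneg (by linarith) (by linarith)) (by linarith)
  have hq0 : 0 < q := by linarith
  have e1 : w 1 = (a23 - 1) * q + a23 * ((a12 - 1) * l) + (a13 - a12 * a23) := by
    rw [w1]; field_simp; ring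
  refine not_eff _ hA w (fun i => i = 1) 1 0 rfl (by simp) ?_ (hsub hw)
  rintro i j rfl
  revert j
  refine idx_cases _ ?_ ?_ ?_ ?_
  · intro _
    rw [blk10, div_mul_eq_mul_div, one_mul, lt_div_iff₀ p12, e1, w0]
    have : 0 < (a12 - 1) * (a13 - a12 * a23) * (l - 1) := 
      mul_pos (mul_pos (by linarith) (by linarith)) (by linarith)
    nlinarith
  · intro h; exact absurd rfl h
  · intro _
    rw [blk12, e1, w2]
    have e : a23 * (1 / a13 * ((a23 - 1) * a12 * q) + 1 / a23 * 0 + (a12 - 1) * l + (a13 - a12 * a23))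
      - ((a23 - 1) * q + a23 * ((a12 - 1) * l) + (a13 - a12 * a23))
      = (a23 - 1) * (a13 - a12 * a23) * (a13 - q) / a13 := by
      field_simp; ring
    have : 0 < (a23 - 1) * (a13 - a12 * a23) * (a13 - q) / a13 := 
      div_pos (mul_pos (mul_pos (by linarith) (by linarith)) (by linarith)) p13
    linarith
  · intro k _
    rw [blk_r, e1, wk]
    have : 0 < (a23 - 1) * (a12 - 1) * (q - l) := 
      mul_pos (mul_pos (by linarith) (by linarith)) (by linarith)
    nlinarith

lemma not_dir2 {m : ℕ} {a12 a13 a23 : ℝ} (p12 : 0 < a12) (p23 : 0 < a23) (h12 : a12 < 1)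
    (h23 : a23 < 1) (h13 : 1 < a13) :
    ¬ (ConeCols (blk m a12 a13 a23) ⊆ EffSet (blk m a12 a13 a23)) := by
  intro hsub
  have p13 : 0 < a13 := by linarith
  have hA := blk_recip (m := m) p12 p13 p23
  obtain ⟨l, hl1, hl2⟩ := exists_between h12
  obtain ⟨q, hq1, hq2⟩ := exists_between h23
  have hl0 : 0 < l := by linarith
  have hq0 : 0 < q := by linarith
  obtain ⟨w, hw, w0, w1, w2, wk⟩ := cvec_mem (m := m) p12 p13 p23
    (x := (1 - a23) * l) (y := (a13 - 1) * q) (z := 1 - a12) (s := 0)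
    (mul_pos (by linarith) hl0) (mul_nonneg (by linarith) (by linarith)) (by linarith) le_rfl
  have hcase : ∀ (k : Fin (m + 1)) (j : Fin (m + 4)), (j : ℕ) < 3 →
      w k.succ.succ.succ < w j := by
    intro k
    refine idx_cases _ ?_ ?_ ?_ ?_
    · intro _
      rw [wk, w0]
      have : 0 < (1 - a12) * (a13 - 1) * (1 - q) :=
        mul_pos (mul_pos (by linarith) (by linarith)) (by linarith)
      nlinarith
    · intro _
      rw [wk, w1]
      have e : (1 / a12 * ((1 - a23) * l) + (a13 - 1) * q + a23 * (1 - a12) + 0) -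
        ((1 - a23) * l + (a13 - 1) * q + (1 - a12) + 0) =
        (1 - a12) * (1 - a23) * (l - a12) / a12 := by field_simp; ring
      have : 0 < (1 - a12) * (1 - a23) * (l - a12) / a12 :=
        div_pos (mul_pos (mul_pos (by linarith) (by linarith)) (by linarith)) p12
      linarith
    · intro _
      rw [wk, w2]
      have e : (1 / a13 * ((1 - a23) * l) + 1 / a23 * ((a13 - 1) * q) + (1 - a12) + 0) -
        ((1 - a23) * l + (a13 - 1) * q + (1 - a12) + 0) =
        (1 - a23) * (a13 - 1) * (q / a23 - l / a13) := by field_simp; ring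
      have g1 : 1 < q / a23 := by rw [one_lt_div p23]; exact hq1
      have g2 : l / a13 < 1 := by rw [div_lt_one p13]; linarith
      have : 0 < (1 - a23) * (a13 - 1) * (q / a23 - l / a13) :=
        mul_pos (mul_pos (by linarith) (by linarith)) (by linarith)
      linarith
    · intro k h
      simp only [Fin.val_succ] at h
      omega
  refine not_eff _ hA w (fun i => 3 ≤ (i : ℕ)) (Fin.succ (Fin.succ (Fin.succ 0))) 0
    (by simp only [Fin.val_succ]; omega) (by simp) ?_ (hsub hw)
  refine idx_cases _ ?_ ?_ ?_ ?_
  · intro j h; simp at h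
  · intro j h; simp at h
  · intro j h; simp [two_mod] at h
  · intro k j _ h
    rw [blk_l, one_mul]
    exact hcase k j (by omega)

/-- Theorem tmain3block: characterization for a 3-block
perturbed consistent matrix, via monomial similarity. -/
theorem coneCols_subset_effSet_iff_three_block {m : ℕ}
    (R S : Matrix (Fin (m + 4)) (Fin (m + 4)) ℝ)
    (hR : IsReciprocal R) (hS : IsMonomial S)
    (a12 a13 a23 : ℝ) (h12 : 0 < a12) (h13 : 0 < a13) (h23 : 0 < a23)
    (hcond : ((1 ≤ a13 ∧ 1 < a12 ∧ 1 < a23) ∨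
      (a13 ≤ a12 ∧ a23 ≤ a13 ∧ a23 = 1) ∨
      (a13 ≤ a23 ∧ a12 ≤ a13 ∧ a12 = 1) ∨
      (1 < a13 ∧ a12 < 1 ∧ a23 < 1)))
    (hSA : ∀ i j : Fin (m + 4), (S * R * S⁻¹) i j =
      if h : (i : ℕ) < 3 ∧ (j : ℕ) < 3 then
        !![1, a12, a13; 1 / a12, 1, a23; 1 / a13, 1 / a23, 1] ⟨i, h.1⟩ ⟨j, h.2⟩
      else 1) :
    ConeCols R ⊆ EffSet R ↔ a13 ≤ a12 * a23 := by
  have hblk : S * R * S⁻¹ = blk m a12 a13 a23 := by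
    ext i j
    rw [hSA]
    rfl
  obtain ⟨σ, d, hd, rfl⟩ := hS
  have hdet : IsUnit (σ.permMatrix ℝ * Matrix.diagonal d).det := by
    rw [Matrix.det_mul, Matrix.det_diagonal, Matrix.det_permutation, isUnit_iff_ne_zero]
    refine mul_ne_zero ?_ (Finset.prod_ne_zero_iff.2 fun i _ => (hd i).ne')
    exact_mod_cast (Int.cast_ne_zero (α := ℝ)).2 (Units.ne_zero (Equiv.Perm.sign σ))
  have hmul : σ.permMatrix ℝ * Matrix.diagonal d * R =
      blk m a12 a13 a23 * (σ.permMatrix ℝ * Matrix.diagonal d) := by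
    rw [← hblk, Matrix.mul_assoc _ _⁻¹, Matrix.nonsing_inv_mul _ hdet, Matrix.mul_one]
  have hent : ∀ i j, d (σ i) * R (σ i) (σ j) = blk m a12 a13 a23 i j * d (σ j) := by
    intro i j
    have h := congrFun (congrFun hmul i) (σ j)
    rw [← Matrix.mul_assoc, Matrix.mul_diagonal, Matrix.mul_assoc, Equiv.Perm.permMatrix,
      PEquiv.toMatrix_toPEquiv_mul, PEquiv.mul_toMatrix_toPEquiv] at h
    simpa using h
  have hmain : ConeCols R ⊆ EffSet R ↔
      ConeCols (blk m a12 a13 a23) ⊆ EffSet (blk m a12 a13 a23) := by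
    constructor
    · refine transfer _ _ σ (fun i => d (σ i)) (fun i => hd _) fun i j => ?_
      rw [hent, mul_div_cancel_right₀ _ (hd _).ne']
    · refine transfer _ _ σ.symm (fun i => (d i)⁻¹) (fun i => inv_pos.2 (hd i)) fun i j => ?_
      have h := hent (σ.symm i) (σ.symm j)
      simp only [Equiv.apply_symm_apply] at h
      have h1 := (hd i).ne'
      have h2 := (hd j).ne'
      field_simp
      linarith
  rw [hmain]
  constructor
  · intro hsub
    by_contra! hlt
    rcases hcond with ⟨c1, c2, c3⟩ | ⟨c1, c2, c3⟩ | ⟨c1, c2, c3⟩ | ⟨c1, c2, c3⟩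
    · exact not_dir1 c2 c3 hlt hsub
    · rw [c3] at hlt; linarith
    · rw [c3] at hlt; linarith
    · exact not_dir2 h12 h23 c2 c3 c1 hsub
  · intro hle
    rcases hcond with ⟨c1, c2, c3⟩ | ⟨c1, c2, c3⟩ | ⟨c1, c2, c3⟩ | ⟨c1, c2, c3⟩
    · exact eff_dir c2.le c1 c3.le hle
    · exact eff_dir (by linarith) (by linarith) (by linarith) hle
    · exact eff_dir (by linarith) (by linarith) (by linarith) hle
    · nlinarith
end

section
/- Let n ≥ 4 and let R be an n×n reciprocal matrix. Suppose S is an n×n monomial matrix such that A = S R S⁻¹ is the n×n reciprocal matrix whose leading 3×3 principal submatrix has rows (1, a_12, a_13), (1/a_12, 1, a_23), (1/a_13, 1/a_23, 1) and all of whose other entries equal 1, where a_12, a_13, a_23 > 0 satisfy one of: (i) a_13 ≥ 1 and a_12, a_23 > 1; (ii) a_12 ≥ a_13 ≥ a_23 = 1; (iii) a_23 ≥ a_13 ≥ a_12 = 1; (iv) a_13 > 1 and a_12, a_23 < 1. If a_13 ≤ a_12·a_23, then every positive eigenvector of R is efficient for R, and every positive eigenvector of R·Rᵀ is efficient for R.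 -/
open Matrix

/-- If `w = A u` for the normalized matrix, the digraph argument shows proportionality. -/
lemma core_three_block {m : ℕ} (A : Matrix (Fin (m + 4)) (Fin (m + 4)) ℝ)
    (a12 a13 a23 : ℝ) (h12 : 1 ≤ a12) (h13 : 1 ≤ a13) (h23 : 1 ≤ a23)
    (hA : ∀ i j : Fin (m + 4), A i j =
      if h : (i : ℕ) < 3 ∧ (j : ℕ) < 3 then
        !![1, a12, a13; 1 / a12, 1, a23; 1 / a13, 1 / a23, 1] ⟨i, h.1⟩ ⟨j, h.2⟩
      else 1)
    (h : a13 ≤ a12 * a23) (u w v : Fin (m + 4) → ℝ) (hu : ∀ i, 0 < u i)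
    (hw : ∀ i, 0 < w i) (hwu : ∀ i, w i = ∑ j, A i j * u j)
    (hv : ∀ i, 0 < v i)
    (hedge : ∀ i j, A i j * w j ≤ w i → v i / w i ≤ v j / w j) :
    ∀ i j, v i / w i = v j / w j := by
  let i0 : Fin (m + 4) := ⟨0, by omega⟩
  let i1 : Fin (m + 4) := ⟨1, by omega⟩
  let i2 : Fin (m + 4) := ⟨2, by omega⟩
  have hsum : ∀ f : Fin (m + 4) → ℝ,
      ∑ j, f j = f i0 + f i1 + f i2 + ∑ k : Fin (m + 1), f k.succ.succ.succ := by
    intro f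
    rw [Fin.sum_univ_succ, Fin.sum_univ_succ, Fin.sum_univ_succ, ← add_assoc, ← add_assoc]
    rfl
  have A1 : ∀ i j : Fin (m + 4), 3 ≤ (j : ℕ) → A i j = 1 := by
    intro i j hj
    rw [hA, dif_neg (by omega)]
  have A1' : ∀ i j : Fin (m + 4), 3 ≤ (i : ℕ) → A i j = 1 := by
    intro i j hj
    rw [hA, dif_neg (by omega)]
  have hlt0 : (i0 : ℕ) < 3 := by simp [i0]
  have hlt1 : (i1 : ℕ) < 3 := by simp [i1]
  have hlt2 : (i2 : ℕ) < 3 := by simp [i2]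
  have A00 : A i0 i0 = 1 := by rw [hA, dif_pos ⟨hlt0, hlt0⟩]; rfl
  have A01 : A i0 i1 = a12 := by rw [hA, dif_pos ⟨hlt0, hlt1⟩]; rfl
  have A02 : A i0 i2 = a13 := by rw [hA, dif_pos ⟨hlt0, hlt2⟩]; rfl
  have A10 : A i1 i0 = 1 / a12 := by rw [hA, dif_pos ⟨hlt1, hlt0⟩]; rfl
  have A11 : A i1 i1 = 1 := by rw [hA, dif_pos ⟨hlt1, hlt1⟩]; rfl
  have A12 : A i1 i2 = a23 := by rw [hA, dif_pos ⟨hlt1, hlt2⟩]; rfl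
  have A20 : A i2 i0 = 1 / a13 := by rw [hA, dif_pos ⟨hlt2, hlt0⟩]; rfl
  have A21 : A i2 i1 = 1 / a23 := by rw [hA, dif_pos ⟨hlt2, hlt1⟩]; rfl
  have A22 : A i2 i2 = 1 := by rw [hA, dif_pos ⟨hlt2, hlt2⟩]; rfl
  have Ak : ∀ (i : Fin (m + 4)) (k : Fin (m + 1)), A i k.succ.succ.succ = 1 := by
    intro i k
    exact A1 _ _ (by simp only [Fin.val_succ]; omega)
  set t : ℝ := ∑ k : Fin (m + 1), u k.succ.succ.succ with ht
  have htpos : 0 ≤ t := Finset.sum_nonneg fun k _ => (hu _).le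
  have w0 : w i0 = u i0 + a12 * u i1 + a13 * u i2 + t := by
    rw [hwu, hsum]
    simp only [A00, A01, A02, Ak, one_mul, ht]
  have w1 : w i1 = 1 / a12 * u i0 + u i1 + a23 * u i2 + t := by
    rw [hwu, hsum]
    simp only [A10, A11, A12, Ak, one_mul, ht]
  have w2 : w i2 = 1 / a13 * u i0 + 1 / a23 * u i1 + u i2 + t := by
    rw [hwu, hsum]
    simp only [A20, A21, A22, Ak, one_mul, ht]
  have w3 : ∀ i : Fin (m + 4), 3 ≤ (i : ℕ) → w i = u i0 + u i1 + u i2 + t := by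
    intro i hi
    rw [hwu, hsum]
    simp only [A1' i _ hi, one_mul, ht]
  have p12 : 0 < a12 := by linarith
  have p13 : 0 < a13 := by linarith
  have p23 : 0 < a23 := by linarith
  have q13 : 1 / a13 ≤ 1 := by rw [div_le_one p13]; exact h13
  have q23 : 1 / a23 ≤ 1 := by rw [div_le_one p23]; exact h23
  have u0 := hu i0
  have u1 := hu i1
  have u2 := hu i2
  have e10 : v i1 / w i1 ≤ v i0 / w i0 := by
    apply hedge
    rw [A10, w0, w1, div_mul_eq_mul_div, one_mul, div_le_iff₀ p12]
    have : (1 / a12 * u i0 + u i1 + a23 * u i2 + t) * a12 =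
        u i0 + a12 * u i1 + (a12 * a23) * u i2 + a12 * t := by field_simp
    rw [this]
    nlinarith [mul_le_mul_of_nonneg_right h u2.le, mul_le_mul_of_nonneg_right h12 htpos]
  have e21 : v i2 / w i2 ≤ v i1 / w i1 := by
    apply hedge
    rw [A21, w1, w2, div_mul_eq_mul_div, one_mul, div_le_iff₀ p23]
    have : (1 / a13 * u i0 + 1 / a23 * u i1 + u i2 + t) * a23 =
        a23 / a13 * u i0 + u i1 + a23 * u i2 + a23 * t := by field_simp
    rw [this]
    have hq : 1 / a12 ≤ a23 / a13 := by
      rw [div_le_div_iff₀ p12 p13]; linarith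
    nlinarith [mul_le_mul_of_nonneg_right hq u0.le, mul_le_mul_of_nonneg_right h23 htpos]
  have e0 : ∀ k : Fin (m + 4), 3 ≤ (k : ℕ) → v i0 / w i0 ≤ v k / w k := by
    intro k hk
    apply hedge
    rw [A1 _ _ hk, w0, w3 k hk]
    nlinarith [mul_le_mul_of_nonneg_right h12 u1.le, mul_le_mul_of_nonneg_right h13 u2.le]
  have e3 : ∀ k : Fin (m + 4), 3 ≤ (k : ℕ) → v k / w k ≤ v i2 / w i2 := by
    intro k hk
    apply hedge
    rw [A1' _ _ hk, w2, w3 k hk]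
    nlinarith [mul_le_mul_of_nonneg_right q23 u1.le, mul_le_mul_of_nonneg_right q13 u0.le]
  have key : ∀ i, v i / w i = v i0 / w i0 := by
    intro i
    have f1 := e0 ⟨3, by omega⟩ (le_refl _)
    have f2 := e3 ⟨3, by omega⟩ (le_refl _)
    by_cases hi : 3 ≤ (i : ℕ)
    · have := e0 i hi
      have := e3 i hi
      linarith
    · have : i = i0 ∨ i = i1 ∨ i = i2 := by
        simp only [i0, i1, i2, Fin.ext_iff]
        omega
      rcases this with rfl | rfl | rfl <;> linarith
  intro i j
  rw [key i, key j]

/-- Positive combinations of the columns of `R` are efficient. -/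
lemma cone_efficient {m : ℕ}
    (R S : Matrix (Fin (m + 4)) (Fin (m + 4)) ℝ)
    (hS : IsMonomial S)
    (a12 a13 a23 : ℝ) (h12 : 1 ≤ a12) (h13 : 1 ≤ a13) (h23 : 1 ≤ a23)
    (hSA : ∀ i j : Fin (m + 4), (S * R * S⁻¹) i j =
      if h : (i : ℕ) < 3 ∧ (j : ℕ) < 3 then
        !![1, a12, a13; 1 / a12, 1, a23; 1 / a13, 1 / a23, 1] ⟨i, h.1⟩ ⟨j, h.2⟩
      else 1)
    (h : a13 ≤ a12 * a23) (u w : Fin (m + 4) → ℝ) (hu : ∀ i, 0 < u i)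
    (hw : ∀ i, 0 < w i) (hwu : w = R.mulVec u) : IsEfficient R w := by
  refine ⟨hw, fun v hv hdom => ?_⟩
  obtain ⟨σ, d, hd, hSd⟩ := hS
  set A := S * R * S⁻¹ with hAdef
  have hdet : IsUnit S.det := by
    rw [hSd, Matrix.det_mul, Matrix.det_permutation, Matrix.det_diagonal]
    refine IsUnit.mul ?_ (IsUnit.mk0 _ (Finset.prod_pos fun i _ => hd i).ne')
    rcases Int.units_eq_one_or (Equiv.Perm.sign σ) with hs | hs <;> simp [hs]
  have hAS : A * S = S * R := by
    rw [hAdef, Matrix.nonsing_inv_mul_cancel_right _ _ hdet]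
  have hS1 : ∀ (M : Matrix (Fin (m + 4)) (Fin (m + 4)) ℝ) i j,
      (S * M) i j = d (σ i) * M (σ i) j := by
    intro M i j
    rw [hSd, Matrix.mul_assoc, Equiv.Perm.permMatrix, PEquiv.toMatrix_toPEquiv_mul]
    simp [Matrix.diagonal_mul]
  have hS2 : ∀ i j, (A * S) i (σ j) = A i j * d (σ j) := by
    intro i j
    rw [hSd, ← Matrix.mul_assoc, Matrix.mul_diagonal, Equiv.Perm.permMatrix, PEquiv.mul_toMatrix_toPEquiv]
    simp
  have hRA : ∀ i j, d (σ i) * R (σ i) (σ j) = A i j * d (σ j) := by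
    intro i j
    rw [← hS2, hAS, hS1]
  have key := core_three_block A a12 a13 a23 h12 h13 h23 hSA h
    (fun i => d (σ i) * u (σ i)) (fun i => d (σ i) * w (σ i)) (fun i => d (σ i) * v (σ i))
    (fun i => mul_pos (hd _) (hu _)) (fun i => mul_pos (hd _) (hw _))
    (by
      intro i
      simp only [hwu, Matrix.mulVec, dotProduct, Finset.mul_sum]
      rw [← Equiv.sum_comp σ]
      refine Finset.sum_congr rfl fun j _ => ?_
      rw [← mul_assoc, hRA, mul_assoc])
    (fun i => mul_pos (hd _) (hv _))
    (by
      intro i j hij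
      have hle : R (σ i) (σ j) ≤ w (σ i) / w (σ j) := by
        rw [le_div_iff₀ (hw _)]
        have e : A i j * (d (σ j) * w (σ j)) = d (σ i) * (R (σ i) (σ j) * w (σ j)) := by
          rw [← mul_assoc, ← hRA, mul_assoc]
        rw [e] at hij
        exact le_of_mul_le_mul_left hij (hd _)
      have h1 := hdom (σ i) (σ j)
      rw [abs_of_nonpos (sub_nonpos.2 hle)] at h1
      have h2 := (abs_le.1 h1).1
      have h3 : v (σ i) / v (σ j) ≤ w (σ i) / w (σ j) := by linarith
      show d (σ i) * v (σ i) / (d (σ i) * w (σ i)) ≤ d (σ j) * v (σ j) / (d (σ j) * w (σ j))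
      rw [mul_div_mul_left _ _ (hd _).ne', mul_div_mul_left _ _ (hd _).ne']
      rw [div_le_div_iff₀ (hv _) (hw _)] at h3
      rw [div_le_div_iff₀ (hw _) (hw _)]
      linarith)
  refine ⟨v 0 / w 0, funext fun i => ?_⟩
  have hk := key (σ.symm i) (σ.symm 0)
  simp only [Equiv.apply_symm_apply] at hk
  rw [mul_div_mul_left _ _ (hd _).ne', mul_div_mul_left _ _ (hd _).ne'] at hk
  rw [Pi.smul_apply, smul_eq_mul, ← hk, div_mul_cancel₀ _ (hw i).ne']

/-- Corollary c3blockPerron: efficiency of the Perron vector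
and of the singular vector of a 3-block perturbed consistent matrix. -/
theorem perron_and_singular_efficient_three_block {m : ℕ}
    (R S : Matrix (Fin (m + 4)) (Fin (m + 4)) ℝ)
    (hR : IsReciprocal R) (hS : IsMonomial S)
    (a12 a13 a23 : ℝ) (h12 : 0 < a12) (h13 : 0 < a13) (h23 : 0 < a23)
    (hcond : ((1 ≤ a13 ∧ 1 < a12 ∧ 1 < a23) ∨
      (a13 ≤ a12 ∧ a23 ≤ a13 ∧ a23 = 1) ∨
      (a13 ≤ a23 ∧ a12 ≤ a13 ∧ a12 = 1) ∨
      (1 < a13 ∧ a12 < 1 ∧ a23 < 1)))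
    (hSA : ∀ i j : Fin (m + 4), (S * R * S⁻¹) i j =
      if h : (i : ℕ) < 3 ∧ (j : ℕ) < 3 then
        !![1, a12, a13; 1 / a12, 1, a23; 1 / a13, 1 / a23, 1] ⟨i, h.1⟩ ⟨j, h.2⟩
      else 1)
    (h : a13 ≤ a12 * a23) :
    (∀ v : Fin (m + 4) → ℝ, (∀ i, 0 < v i) →
        (∃ lam : ℝ, R.mulVec v = lam • v) → IsEfficient R v) ∧
    (∀ v : Fin (m + 4) → ℝ, (∀ i, 0 < v i) →
        (∃ lam : ℝ, (R * Rᵀ).mulVec v = lam • v) → IsEfficient R v) := by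
  have hge : 1 ≤ a12 ∧ 1 ≤ a13 ∧ 1 ≤ a23 := by
    rcases hcond with ⟨h1, h2, h3⟩ | ⟨h1, h2, h3⟩ | ⟨h1, h2, h3⟩ | ⟨h1, h2, h3⟩
    · exact ⟨h2.le, h1, h3.le⟩
    · exact ⟨by linarith, by linarith, by linarith⟩
    · exact ⟨by linarith, by linarith, by linarith⟩
    · nlinarith
  obtain ⟨g12, g13, g23⟩ := hge
  have hpos : ∀ (M : Matrix (Fin (m + 4)) (Fin (m + 4)) ℝ) (x : Fin (m + 4) → ℝ),
      (∀ i j, 0 < M i j) → (∀ i, 0 < x i) → ∀ i, 0 < M.mulVec x i := by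
    intro M x hM hx i
    exact Finset.sum_pos (fun j _ => mul_pos (hM i j) (hx j)) Finset.univ_nonempty
  have main : ∀ v x : Fin (m + 4) → ℝ, (∀ i, 0 < v i) → (∀ i, 0 < x i) →
      (∃ lam : ℝ, R.mulVec x = lam • v) → IsEfficient R v := by
    rintro v x hv hx ⟨lam, hlam⟩
    have h0 := hpos R x hR.1 hx 0
    rw [hlam, Pi.smul_apply, smul_eq_mul] at h0
    have hl : 0 < lam := pos_of_mul_pos_left h0 (hv 0).le
    refine cone_efficient R S hS a12 a13 a23 g12 g13 g23 hSA h (lam⁻¹ • x) v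
      (fun i => mul_pos (inv_pos.2 hl) (hx i)) hv ?_
    rw [Matrix.mulVec_smul, hlam, smul_smul, inv_mul_cancel₀ hl.ne', one_smul]
  refine ⟨fun v hv hl => main v v hv hv hl, fun v hv hl => ?_⟩
  refine main v (Rᵀ.mulVec v) hv (hpos Rᵀ v (fun i j => hR.1 j i) hv) ?_
  simpa [Matrix.mulVec_mulVec] using hl
end
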